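/- arXiv:math/0702698 — 12 statements merged into one kernel-verified Lean document; each statement's English description precedes it below -/
import Mathlib

section
/- Let I ⊆ ℝ be an interval containing 0 and let u : I → ℝ be a twice differentiable solution of u(x) − x·u′(x) = u″(x)/(1 + u′(x)²) on I with u(0) = 0. Then u is linear: u(x) = u′(0)·x for all x ∈ I. In particular, the only solutions whose graph passes through the origin are straight lines through the origin. -/
/-- If `w' = -x·a(x)·w` on an interval containing `0`, with `a ≥ 0` and `w(0) = 0`,
then `w` vanishes identically. -/
theorem eq_zero_of_hasDerivAt_neg_id_mul {I : Set ℝ} (hI : I.OrdConnected) (h0I : (0 : ℝ) ∈ I)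
    {w a : ℝ → ℝ} (ha : ∀ x ∈ I, 0 ≤ a x)
    (hw : ∀ x ∈ I, HasDerivAt w (-(x * a x * w x)) x) (h0 : w 0 = 0) :
    ∀ x ∈ I, w x = 0 := by
  have hsq : ∀ x ∈ I, HasDerivAt (fun y => w y ^ 2) (-(2 * x * (a x * w x ^ 2))) x :=
    fun x hx => ((hw x hx).pow 2).congr_deriv (by push_cast; ring)
  have hnn : ∀ x ∈ I, 0 ≤ a x * w x ^ 2 := fun x hx => mul_nonneg (ha x hx) (sq_nonneg _)
  have hle : ∀ x ∈ I, w x ^ 2 ≤ w 0 ^ 2 := by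
    intro x hx
    rcases le_total 0 x with h | h
    · have hs : Set.Icc 0 x ⊆ I := hI.out h0I hx
      refine antitoneOn_of_hasDerivWithinAt_nonpos (convex_Icc 0 x)
        (fun y hy => (hsq y (hs hy)).continuousAt.continuousWithinAt)
        (fun y hy => (hsq y (hs (interior_subset hy))).hasDerivWithinAt) (fun y hy => ?_)
        (Set.left_mem_Icc.2 h) (Set.right_mem_Icc.2 h) h
      have hy' := interior_subset hy
      nlinarith [mul_nonneg hy'.1 (hnn y (hs hy'))]
    · have hs : Set.Icc x 0 ⊆ I := hI.out hx h0I
      refine monotoneOn_of_hasDerivWithinAt_nonneg (convex_Icc x 0)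
        (fun y hy => (hsq y (hs hy)).continuousAt.continuousWithinAt)
        (fun y hy => (hsq y (hs (interior_subset hy))).hasDerivWithinAt) (fun y hy => ?_)
        (Set.left_mem_Icc.2 h) (Set.right_mem_Icc.2 h) h
      have hy' := interior_subset hy
      nlinarith [mul_nonneg (neg_nonneg.2 hy'.2) (hnn y (hs hy'))]
  intro x hx
  have h := hle x hx
  rw [h0] at h
  exact pow_eq_zero_iff two_ne_zero |>.1 (le_antisymm (by simpa using h) (sq_nonneg _))

/-- A twice differentiable solution of the self-expander ODE
`u(x) - x·u'(x) = u''(x)/(1 + u'(x)²)` on an interval `I` containing `0`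
with `u(0) = 0` is linear: `u(x) = u'(0)·x` on `I`. -/
theorem self_expander_through_origin_is_line
    (I : Set ℝ) (hI : I.OrdConnected) (h0I : (0 : ℝ) ∈ I)
    (u : ℝ → ℝ)
    (hu1 : ∀ x ∈ I, DifferentiableAt ℝ u x)
    (hu2 : ∀ x ∈ I, DifferentiableAt ℝ (deriv u) x)
    (hode : ∀ x ∈ I, u x - x * deriv u x = deriv (deriv u) x / (1 + (deriv u x) ^ 2))
    (h0 : u 0 = 0) :
    ∀ x ∈ I, u x = deriv u 0 * x := by
  have hdd : ∀ x ∈ I, deriv (deriv u) x = (u x - x * deriv u x) * (1 + deriv u x ^ 2) := by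
    intro x hx
    rw [hode x hx, div_mul_cancel₀ _ (by positivity)]
  have hw : ∀ x ∈ I, u x - x * deriv u x = 0 := by
    refine eq_zero_of_hasDerivAt_neg_id_mul hI h0I (a := fun x => 1 + deriv u x ^ 2)
      (fun x _ => by positivity) (fun x hx => ?_) (by simp [h0])
    refine ((hu1 x hx).hasDerivAt.sub
      ((hasDerivAt_id x).mul (hu2 x hx).hasDerivAt)).congr_deriv ?_
    rw [hdd x hx]
    simp only [id]
    ring
  intro x hx
  have hconst := hI.convex.norm_image_sub_le_of_norm_hasDerivWithin_le (C := 0)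
    (fun y hy => (hu2 y hy).hasDerivAt.hasDerivWithinAt)
    (fun y hy => by rw [hdd y hy, hw y hy]; simp) h0I hx
  rw [zero_mul, norm_le_zero_iff, sub_eq_zero] at hconst
  rw [← hconst, mul_comm]
  exact sub_eq_zero.1 (hw x hx)
end

section
/- Let u be a twice differentiable solution of u(x) − x·u′(x) = u″(x)/(1 + u′(x)²) on an interval [0, x_max) with u(0) > 0. Then u is strictly convex on [0, x_max), i.e. u″(x) > 0 for all x ∈ [0, x_max). -/
/-- A solution of the linear equation `w' = -a w` with continuous coefficient `a` that is positive
at the left endpoint of an interval stays positive on it. -/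
theorem pos_of_hasDerivAt_neg_mul_self {a w : ℝ → ℝ} {c b : ℝ} (hcb : c ≤ b)
    (ha : ContinuousOn a (Set.Icc c b))
    (hw : ∀ x ∈ Set.Icc c b, HasDerivAt w (-a x * w x) x) (hc : 0 < w c) : 0 < w b := by
  obtain ⟨M, hM⟩ := (isCompact_Icc.image_of_continuousOn ha).bddAbove
  have hM' : ∀ x ∈ Set.Icc c b, a x ≤ M := fun x hx => hM ⟨x, hx, rfl⟩
  have hderiv : ∀ x ∈ Set.Icc c b, HasDerivAt (fun y => w y ^ 2 * Real.exp (2 * M * y))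
      (2 * (M - a x) * (w x ^ 2 * Real.exp (2 * M * x))) x := by
    intro x hx
    refine (((hw x hx).pow 2).mul (((hasDerivAt_id x).const_mul (2 * M)).exp)).congr_deriv ?_
    simp
    ring
  have hmono : MonotoneOn (fun y => w y ^ 2 * Real.exp (2 * M * y)) (Set.Icc c b) := by
    refine monotoneOn_of_deriv_nonneg (convex_Icc c b)
      (fun x hx => (hderiv x hx).continuousAt.continuousWithinAt)
      (fun x hx => (hderiv x (interior_subset hx)).differentiableAt.differentiableWithinAt)
      fun x hx => ?_
    rw [(hderiv x (interior_subset hx)).deriv]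
    have := sub_nonneg.2 (hM' x (interior_subset hx))
    positivity
  by_contra! hb
  obtain ⟨z, hz, hz0⟩ := intermediate_value_Icc' hcb
    (fun x hx => (hw x hx).continuousAt.continuousWithinAt) ⟨hb, hc.le⟩
  have hle : w c ^ 2 * Real.exp (2 * M * c) ≤ w z ^ 2 * Real.exp (2 * M * z) :=
    hmono (Set.left_mem_Icc.2 hcb) hz hz.1
  have hpos : 0 < w c ^ 2 * Real.exp (2 * M * c) := by positivity
  simp only [hz0] at hle
  linarith


/-- A twice differentiable solution of the self-expander ODE
`u(x) - x·u'(x) = u''(x)/(1 + u'(x)²)` on `[0, x_max)` with `u(0) > 0`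
is strictly convex there: `u''(x) > 0` for all `x ∈ [0, x_max)`. -/
theorem self_expander_strictly_convex
    (xmax : ℝ) (u : ℝ → ℝ)
    (hu1 : ∀ x ∈ Set.Ico (0 : ℝ) xmax, DifferentiableAt ℝ u x)
    (hu2 : ∀ x ∈ Set.Ico (0 : ℝ) xmax, DifferentiableAt ℝ (deriv u) x)
    (hode : ∀ x ∈ Set.Ico (0 : ℝ) xmax,
      u x - x * deriv u x = deriv (deriv u) x / (1 + (deriv u x) ^ 2))
    (h0 : 0 < u 0) :
    ∀ x ∈ Set.Ico (0 : ℝ) xmax, 0 < deriv (deriv u) x := by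
  intro b hb
  have hpos (x : ℝ) : 0 < 1 + deriv u x ^ 2 := by positivity
  have hsub : Set.Icc 0 b ⊆ Set.Ico 0 xmax := fun x hx => ⟨hx.1, hx.2.trans_lt hb.2⟩
  have hu'' : ∀ x ∈ Set.Ico (0 : ℝ) xmax,
      deriv (deriv u) x = (1 + deriv u x ^ 2) * (u x - x * deriv u x) := by
    intro x hx
    rw [hode x hx, mul_div_cancel₀ _ (hpos x).ne']
  have hcont : ContinuousOn (fun x => x * (1 + deriv u x ^ 2)) (Set.Icc 0 b) := by
    have : ContinuousOn (deriv u) (Set.Icc 0 b) := fun x hx =>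
      (hu2 x (hsub hx)).continuousAt.continuousWithinAt
    fun_prop
  have hw : 0 < u b - b * deriv u b := by
    refine pos_of_hasDerivAt_neg_mul_self (w := fun x => u x - x * deriv u x) hb.1 hcont
      (fun x hx => ?_) (by simpa using h0)
    refine ((hu1 x (hsub hx)).hasDerivAt.sub
      ((hasDerivAt_id x).mul (hu2 x (hsub hx)).hasDerivAt)).congr_deriv ?_
    rw [hu'' x (hsub hx)]
    simp only [id]
    ring
  rw [hu'' b hb]
  exact mul_pos (hpos b) hw
end

section
/- For every h > 0 and every s ∈ ℝ, there exists a smooth function u : [0, ∞) → ℝ with u(0) = h and u′(0) = s that satisfies u(x) − x·u′(x) = u″(x)/(1 + u′(x)²) for all x ≥ 0. That is, the initial value problem for the self-expander ODE has a global solution on [0, ∞). -/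
open Set Filter Topology
open scoped NNReal ContDiff Manifold

/-- An upper bound, independent of time, for the slope at `t ≥ 0` of a solution with height `h` and
slope `s` at `0`. -/
noncomputable def slopeBound (h s : ℝ) : ℝ :=
  Real.tan ((Real.pi / 2 + Real.arctan s) / 2) + h / ((Real.pi / 2 - Real.arctan s) / (2 * h))

lemma forward_bounds {h T : ℝ} (hh : 0 < h) {p w g : ℝ → ℝ}
    (hp : ∀ t ∈ Icc 0 T, HasDerivWithinAt p (g t) (Icc 0 T) t)
    (hw : ∀ t ∈ Icc 0 T, HasDerivWithinAt w (-t * g t) (Icc 0 T) t)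
    (hg0 : ∀ t ∈ Icc 0 T, 0 ≤ g t) (hg1 : ∀ t ∈ Icc 0 T, g t ≤ h * (1 + p t ^ 2))
    (hg2 : ∀ t ∈ Icc 0 T, w t < 0 → g t = 0) (hw0 : w 0 = h) {t : ℝ} (ht : t ∈ Icc 0 T) :
    w t ∈ Icc 0 h ∧ p t ∈ Icc (p 0) (slopeBound h (p 0)) := by
  have hpc : ContinuousOn p (Icc 0 T) := fun x hx => (hp x hx).continuousWithinAt
  have hwc : ContinuousOn w (Icc 0 T) := fun x hx => (hw x hx).continuousWithinAt
  have h0 : (0 : ℝ) ∈ Icc 0 T := ⟨le_rfl, ht.1.trans ht.2⟩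
  have hpm : MonotoneOn p (Icc 0 T) :=
    monotoneOn_of_hasDerivWithinAt_nonneg (convex_Icc 0 T) hpc
      (fun x hx => (hp x (interior_subset hx)).mono interior_subset)
      fun x hx => hg0 x (interior_subset hx)
  have hwm : AntitoneOn w (Icc 0 T) :=
    antitoneOn_of_hasDerivWithinAt_nonpos (convex_Icc 0 T) hwc
      (fun x hx => (hw x (interior_subset hx)).mono interior_subset)
      fun x hx => by nlinarith [hg0 x (interior_subset hx), (interior_subset hx : x ∈ Icc 0 T).1]
  have hwnn : ∀ x ∈ Icc 0 T, 0 ≤ w x := by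
    intro x hx
    have key : ∀ ε > 0, -w x ≤ ε * (x + 1) := by
      intro ε hε
      refine image_le_of_deriv_right_lt_deriv_boundary (f := fun y => -w y)
        (f' := fun y => -(-y * g y)) (B := fun y => ε * (y + 1)) (B' := fun _ => ε) hwc.neg
        (fun y hy => ?_) (by simp only [hw0]; nlinarith) (fun y => ?_) (fun y hy hyw => ?_) hx
      · exact ((hw y (Ico_subset_Icc_self hy)).mono_of_mem_nhdsWithin
          (Icc_mem_nhdsGE_of_mem hy)).neg
      · simpa using ((hasDerivAt_id y).add_const (1 : ℝ)).const_mul ε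
      · have : 0 < ε * (y + 1) := mul_pos hε (by linarith [hy.1])
        rw [hg2 y (Ico_subset_Icc_self hy) (by linarith)]
        simpa using hε
    by_contra! hneg
    have hx1 : 0 < 2 * (x + 1) := by linarith [hx.1]
    have := key (-w x / (2 * (x + 1))) (div_pos (by linarith) hx1)
    have e : -w x / (2 * (x + 1)) * (x + 1) = -w x / 2 := by
      have : x + 1 ≠ 0 := by linarith
      field_simp
    linarith
  refine ⟨⟨hwnn t ht, hw0 ▸ hwm h0 ht ht.1⟩, hpm h0 ht ht.1, ?_⟩
  have harc : ∀ x ∈ Icc 0 T, Real.arctan (p x) ≤ Real.arctan (p 0) + h * x := by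
    intro x hx
    have : AntitoneOn (fun y => Real.arctan (p y) - h * y) (Icc 0 T) := by
      refine antitoneOn_of_hasDerivWithinAt_nonpos (f' := fun y => 1 / (1 + p y ^ 2) * g y - h)
        (convex_Icc 0 T) (by fun_prop) (fun y hy => ?_) fun y hy => ?_
      · have := ((hp y (interior_subset hy)).mono interior_subset).arctan.sub
          (((hasDerivAt_id y).const_mul h).hasDerivWithinAt (s := interior (Icc 0 T)))
        exact this.congr_deriv (by simp)
      · have := hg1 y (interior_subset hy)
        have h1 : 0 < 1 + p y ^ 2 := by positivity
        rw [sub_nonpos, one_div_mul_eq_div, div_le_iff₀ h1]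
        exact this
    have := this h0 hx hx.1
    simp only [mul_zero, sub_zero] at this
    linarith
  have hlt := Real.arctan_lt_pi_div_two (p 0)
  have hgt := Real.neg_pi_div_two_lt_arctan (p 0)
  set δ := (Real.pi / 2 - Real.arctan (p 0)) / (2 * h) with hδ
  have hδ0 : 0 < δ := by rw [hδ]; apply div_pos <;> linarith
  have hδh : h * δ = (Real.pi / 2 - Real.arctan (p 0)) / 2 := by rw [hδ]; field_simp
  have hsmall : ∀ x ∈ Icc 0 T, x ≤ δ →
      p x ≤ Real.tan ((Real.pi / 2 + Real.arctan (p 0)) / 2) := by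
    intro x hx hxδ
    have h1 := harc x hx
    have h2 : h * x ≤ h * δ := by gcongr
    rw [← Real.tan_arctan (p x)]
    refine Real.strictMonoOn_tan.monotoneOn ⟨Real.neg_pi_div_two_lt_arctan _,
      Real.arctan_lt_pi_div_two _⟩ ⟨by linarith, by linarith⟩ (by linarith)
  have hhδ : 0 ≤ h / δ := by positivity
  rw [slopeBound, ← hδ]
  rcases le_total t δ with htδ | htδ
  · linarith [hsmall t ht htδ]
  · have hsub : Icc δ T ⊆ Icc 0 T := Icc_subset_Icc_left hδ0.le
    have : AntitoneOn (fun y => δ * p y + w y) (Icc δ T) := by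
      refine antitoneOn_of_hasDerivWithinAt_nonpos (f' := fun y => δ * g y + -y * g y)
        (convex_Icc δ T) (((hpc.const_mul δ).add hwc).mono hsub) (fun y hy => ?_) fun y hy => ?_
      · have hy' := hsub (interior_subset hy)
        exact (((hp y hy').const_mul δ).add (hw y hy')).mono (interior_subset.trans hsub)
      · have hy' : y ∈ Icc δ T := interior_subset hy
        nlinarith [hg0 y (hsub hy'), hy'.1]
    have hδm : δ ∈ Icc δ T := ⟨le_rfl, htδ.trans ht.2⟩
    have h1 := this hδm ⟨htδ, ht.2⟩ htδ
    have h2 := hsmall δ (hsub hδm) le_rfl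
    have h3 := hwnn t ht
    have h4 : w δ ≤ h := hw0 ▸ hwm h0 (hsub hδm) hδ0.le
    have h5 : h / δ * δ = h := by field_simp
    simp only at h1
    have : δ * p t ≤ δ * (p δ + h / δ) := by linarith
    have := le_of_mul_le_mul_left this hδ0
    linarith

/-- Truncation of a real number to `[a, b]`. -/
def clip (a b x : ℝ) : ℝ := max a (min b x)

lemma clip_mem {a b : ℝ} (hab : a ≤ b) (x : ℝ) : clip a b x ∈ Icc a b :=
  ⟨le_max_left _ _, max_le hab (min_le_left _ _)⟩

lemma clip_of_mem {a b x : ℝ} (hx : x ∈ Icc a b) : clip a b x = x := by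
  rw [clip, min_eq_right hx.2, max_eq_right hx.1]

lemma abs_clip_sub_clip_le (a b x y : ℝ) : |clip a b x - clip a b y| ≤ |x - y| := by
  simpa [Real.dist_eq, clip] using
    ((LipschitzWith.id (α := ℝ)).const_min b |>.const_max a).dist_le_mul x y

lemma clip_sq_le {M : ℝ} (hM : 0 ≤ M) (x : ℝ) : clip (-M) M x ^ 2 ≤ x ^ 2 := by
  rw [sq_le_sq]
  simpa [clip, hM] using abs_clip_sub_clip_le (-M) M x 0

lemma clip_of_neg {b x : ℝ} (hx : x < 0) (hb : 0 ≤ b) : clip 0 b x = 0 := by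
  rw [clip, min_eq_right (hx.le.trans hb), max_eq_left hx.le]

/-- Truncation of `w * (1 + p ^ 2)`. -/
def truncField (h M : ℝ) (x : ℝ × ℝ) : ℝ := clip 0 h x.2 * (1 + clip (-M) M x.1 ^ 2)

lemma truncField_nonneg {h : ℝ} (hh : 0 ≤ h) (M : ℝ) (x : ℝ × ℝ) : 0 ≤ truncField h M x :=
  mul_nonneg (clip_mem hh _).1 (by positivity)

lemma truncField_le {h M : ℝ} (hh : 0 ≤ h) (hM : 0 ≤ M) (x : ℝ × ℝ) :
    truncField h M x ≤ h * (1 + M ^ 2) := by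
  have h1 := clip_mem hh x.2
  have h2 := clip_mem (neg_le_self hM) x.1
  exact mul_le_mul h1.2 (by nlinarith [h2.1, h2.2]) (by positivity) hh

lemma truncField_sub_le {h M : ℝ} (hh : 0 ≤ h) (hM : 0 ≤ M) (x y : ℝ × ℝ) :
    |truncField h M x - truncField h M y| ≤ (1 + M ^ 2 + 2 * M * h) * ‖x - y‖ := by
  have hx2 := clip_mem hh x.2
  have hx1 := clip_mem (neg_le_self hM) x.1
  have hy1 := clip_mem (neg_le_self hM) y.1
  have hy2 := clip_mem hh y.2
  have e1 : |clip (-M) M x.1 - clip (-M) M y.1| ≤ ‖x - y‖ :=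
    (abs_clip_sub_clip_le _ _ _ _).trans (norm_fst_le (x - y))
  have e2 : |clip 0 h x.2 - clip 0 h y.2| ≤ ‖x - y‖ :=
    (abs_clip_sub_clip_le _ _ _ _).trans (norm_snd_le (x - y))
  unfold truncField
  generalize clip (-M) M x.1 = a at *
  generalize clip (-M) M y.1 = b at *
  generalize clip 0 h x.2 = c at *
  generalize clip 0 h y.2 = d at *
  have : c * (1 + a ^ 2) - d * (1 + b ^ 2) =
      (c - d) * (1 + a ^ 2) + d * (a + b) * (a - b) := by ring
  rw [this]
  refine (abs_add_le _ _).trans ?_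
  rw [abs_mul, abs_mul, abs_mul, abs_of_nonneg hy2.1, abs_of_nonneg (by positivity : 0 ≤ 1 + a ^ 2)]
  have h3 : |a + b| ≤ 2 * M := abs_le.2 ⟨by linarith [hx1.1, hy1.1], by linarith [hx1.2, hy1.2]⟩
  have h4 : a ^ 2 ≤ M ^ 2 := by nlinarith [hx1.1, hx1.2]
  calc _ ≤ ‖x - y‖ * (1 + M ^ 2) + h * (2 * M) * ‖x - y‖ := by
        gcongr
        exact hy2.2
    _ = _ := by ring

lemma exists_truncated_solution {h M T : ℝ} (hh : 0 ≤ h) (hM : 0 ≤ M) (hT : 0 ≤ T) (x₀ : ℝ × ℝ) :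
    ∃ α : ℝ → ℝ × ℝ, α 0 = x₀ ∧ ∀ t ∈ Icc (-T) T, HasDerivWithinAt α
      (truncField h M (α t), -t * truncField h M (α t)) (Icc (-T) T) t := by
  have hB : 0 ≤ h * (1 + M ^ 2) := by positivity
  have hK : 0 ≤ 1 + M ^ 2 + 2 * M * h := by positivity
  lift h * (1 + M ^ 2) to ℝ≥0 using hB with B hBe
  lift 1 + M ^ 2 + 2 * M * h to ℝ≥0 using hK with K hKe
  lift T to ℝ≥0 using hT
  have hnorm : ∀ t ∈ Icc (-(T : ℝ)) T, ∀ r : ℝ, ‖(r, -t * r)‖ ≤ (1 + T) * |r| := by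
    intro t ht r
    have ht' : |t| ≤ T := abs_le.2 ht
    refine max_le ?_ ?_
    · change |r| ≤ _
      nlinarith [abs_nonneg r, T.2, mul_nonneg T.2 (abs_nonneg r)]
    · change |-t * r| ≤ _
      rw [abs_mul, abs_neg]
      nlinarith [abs_nonneg r, mul_le_mul_of_nonneg_right ht' (abs_nonneg r)]
  have hPL : IsPicardLindelof
      (fun t x => (truncField h M x, -t * truncField h M x))
      (⟨0, by simp⟩ : Icc (-(T : ℝ)) T) x₀ ((1 + T) * B * T) 0 ((1 + T) * B) ((1 + T) * K) := by
    constructor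
    · intro t ht
      refine LipschitzOnWith.of_dist_le_mul fun x _ y _ => ?_
      rw [dist_eq_norm, dist_eq_norm, Prod.mk_sub_mk, ← mul_sub]
      refine (hnorm t ht _).trans ?_
      have := truncField_sub_le hh hM x y
      push_cast
      rw [mul_assoc, hKe]
      gcongr
    · intro x _
      fun_prop
    · intro t ht x _
      refine (hnorm t ht _).trans ?_
      rw [abs_of_nonneg (truncField_nonneg hh M x)]
      push_cast
      rw [hBe]
      gcongr
      exact truncField_le hh hM x
    · simp
  exact hPL.exists_eq_forall_mem_Icc_hasDerivWithinAt₀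

lemma exists_solution_on_Icc {h : ℝ} (hh : 0 < h) (s : ℝ) {T : ℝ} (hT : 0 ≤ T) :
    ∃ p w : ℝ → ℝ, p 0 = s ∧ w 0 = h ∧ ∀ t ∈ Icc (-T) T,
      HasDerivWithinAt p (w t * (1 + p t ^ 2)) (Icc (-T) T) t ∧
      HasDerivWithinAt w (-t * (w t * (1 + p t ^ 2))) (Icc (-T) T) t := by
  set M := max |s| (max (slopeBound h s) (slopeBound h (-s)))
  have hs : |s| ≤ M := le_max_left _ _
  have hb1 : slopeBound h s ≤ M := (le_max_left _ _).trans (le_max_right _ _)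
  have hb2 : slopeBound h (-s) ≤ M := (le_max_right _ _).trans (le_max_right _ _)
  have hM : 0 ≤ M := (abs_nonneg s).trans hs
  rw [abs_le] at hs
  obtain ⟨α, hα0, hα⟩ := exists_truncated_solution (h := h) hh.le hM hT (s, h)
  have hp : ∀ t ∈ Icc (-T) T, HasDerivWithinAt (fun t => (α t).1) (truncField h M (α t))
      (Icc (-T) T) t := fun t ht => (hα t ht).fst
  have hw : ∀ t ∈ Icc (-T) T, HasDerivWithinAt (fun t => (α t).2) (-t * truncField h M (α t))
      (Icc (-T) T) t := fun t ht => (hα t ht).snd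
  have hle : ∀ x : ℝ × ℝ, truncField h M x ≤ h * (1 + x.1 ^ 2) := fun x =>
    mul_le_mul (clip_mem hh.le _).2 (by linarith [clip_sq_le hM x.1]) (by positivity) hh.le
  have hz : ∀ x : ℝ × ℝ, x.2 < 0 → truncField h M x = 0 := fun x hx => by
    rw [truncField, clip_of_neg hx hh.le, zero_mul]
  have hsub : Icc 0 T ⊆ Icc (-T) T := Icc_subset_Icc_left (by linarith)
  have hmaps : MapsTo (fun t : ℝ => -t) (Icc 0 T) (Icc (-T) T) := fun t ht =>
    ⟨by linarith [ht.2], by linarith [ht.1]⟩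
  have hbd : ∀ t ∈ Icc (-T) T, (α t).2 ∈ Icc 0 h ∧ (α t).1 ∈ Icc (-M) M := by
    intro t ht
    rcases le_total 0 t with h0 | h0
    · obtain ⟨h1, h2⟩ := forward_bounds (T := T) hh (fun t ht => (hp t (hsub ht)).mono hsub)
        (fun t ht => (hw t (hsub ht)).mono hsub) (fun t _ => truncField_nonneg hh.le M _)
        (fun t _ => hle _) (fun t _ => hz _) (by simp [hα0]) ⟨h0, ht.2⟩
      simp only [hα0] at h2
      exact ⟨h1, by linarith [h2.1], by linarith [h2.2]⟩
    · obtain ⟨h1, h2⟩ := forward_bounds (T := T) hh (p := fun t => -(α (-t)).1)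
        (w := fun t => (α (-t)).2) (g := fun t => truncField h M (α (-t)))
        (fun t ht => ((hp (-t) (hmaps ht)).scomp t
          (hasDerivAt_neg t).hasDerivWithinAt hmaps).neg.congr_deriv (by simp))
        (fun t ht => ((hw (-t) (hmaps ht)).scomp t
          (hasDerivAt_neg t).hasDerivWithinAt hmaps).congr_deriv (by simp))
        (fun t _ => truncField_nonneg hh.le M _)
        (fun t _ => by simpa using hle (α (-t))) (fun t _ => hz _) (by simp [hα0])
        (t := -t) ⟨by linarith, by linarith [ht.1]⟩
      simp only [hα0, neg_neg, neg_zero] at h1 h2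
      exact ⟨h1, by linarith [h2.2], by linarith [h2.1]⟩
  refine ⟨fun t => (α t).1, fun t => (α t).2, by simp [hα0], by simp [hα0], fun t ht => ?_⟩
  have e : truncField h M (α t) = (α t).2 * (1 + (α t).1 ^ 2) := by
    rw [truncField, clip_of_mem (hbd t ht).1, clip_of_mem (hbd t ht).2]
  rw [← e]
  exact ⟨hp t ht, hw t ht⟩

lemma exists_global_solution {h : ℝ} (hh : 0 < h) (s : ℝ) :
    ∃ p w : ℝ → ℝ, p 0 = s ∧ w 0 = h ∧ ∀ t,
      HasDerivAt p (w t * (1 + p t ^ 2)) t ∧ HasDerivAt w (-t * (w t * (1 + p t ^ 2))) t := by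
  let v : ℝ × ℝ × ℝ → ℝ × ℝ × ℝ := fun x =>
    (1, x.2.2 * (1 + x.2.1 ^ 2), -x.1 * (x.2.2 * (1 + x.2.1 ^ 2)))
  have hv : ContDiff ℝ 1 v := by fun_prop
  obtain ⟨γ, hγ0, hγ⟩ := (exists_isMIntegralCurve_iff_exists_isMIntegralCurveOn_Ioo
    (I := 𝓘(ℝ, ℝ × ℝ × ℝ)) (v := v) (contMDiff_vectorSpace_iff_contDiff.2 hv)
    ((0, s, h) : ℝ × ℝ × ℝ)).2 fun a => by
      obtain ⟨p, w, hp0, hw0, hpw⟩ := exists_solution_on_Icc hh s (abs_nonneg a)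
      refine ⟨fun t => (t, p t, w t), by simp [hp0, hw0], fun t ht => ?_⟩
      have hsub : Ioo (-a) a ⊆ Icc (-|a|) |a| := Ioo_subset_Icc_self.trans
        (Icc_subset_Icc (neg_le_neg (le_abs_self a)) (le_abs_self a))
      have h1 := (hasDerivWithinAt_id t (Ioo (-a) a)).prodMk
        (((hpw t (hsub ht)).1.mono hsub).prodMk ((hpw t (hsub ht)).2.mono hsub))
      exact h1.hasFDerivWithinAt.hasMFDerivWithinAt
  have hd : ∀ t, HasDerivAt γ (v (γ t)) t := fun t => by
    have : HasFDerivAt γ (ContinuousLinearMap.smulRight (1 : ℝ →L[ℝ] ℝ) (v (γ t))) t :=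
      hasMFDerivAt_iff_hasFDerivAt.1 (hγ t)
    simpa using this.hasDerivAt
  have h1 : ∀ t, (γ t).1 = t := by
    have : ∀ t, HasDerivAt (fun t => (γ t).1 - t) 0 t := fun t => by
      have h : HasDerivAt (fun t => (γ t).1) 1 t := (hd t).fst
      exact (HasDerivAt.sub h (hasDerivAt_id t)).congr_deriv (sub_self 1)
    intro t
    have := is_const_of_deriv_eq_zero (fun t => (this t).differentiableAt)
      (fun t => (this t).deriv) t 0
    simp only [hγ0] at this
    linarith
  refine ⟨fun t => (γ t).2.1, fun t => (γ t).2.2, by simp [hγ0], by simp [hγ0], fun t => ?_⟩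
  have h2 := (hd t).snd
  simp only [v, h1] at h2
  exact ⟨h2.fst, h2.snd⟩

/-- For every initial height `h > 0` and initial slope `s`, the
initial value problem for the self-expander ODE
`u(x) - x·u'(x) = u''(x)/(1 + u'(x)²)` has a global smooth solution on
`[0, ∞)` with `u(0) = h` and `u'(0) = s`. -/
theorem self_expander_global_existence (h s : ℝ) (hh : 0 < h) :
    ∃ u : ℝ → ℝ, ContDiff ℝ (⊤ : ℕ∞) u ∧ u 0 = h ∧ deriv u 0 = s ∧
      ∀ x : ℝ, 0 ≤ x →
        u x - x * deriv u x = deriv (deriv u) x / (1 + (deriv u x) ^ 2) := by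
  obtain ⟨p, w, hp0, hw0, hpw⟩ := exists_global_solution hh s
  have hsm : ∀ n : ℕ, ContDiff ℝ n p ∧ ContDiff ℝ n w := by
    intro n
    induction n with
    | zero =>
      exact ⟨contDiff_zero.2 <| continuous_iff_continuousAt.2 fun t => (hpw t).1.continuousAt,
        contDiff_zero.2 <| continuous_iff_continuousAt.2 fun t => (hpw t).2.continuousAt⟩
    | succ n ih =>
      obtain ⟨h1, h2⟩ := ih
      push_cast
      rw [contDiff_succ_iff_deriv, contDiff_succ_iff_deriv, funext fun t => (hpw t).1.deriv,
        funext fun t => (hpw t).2.deriv]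
      refine ⟨⟨fun t => (hpw t).1.differentiableAt, by simp, by fun_prop⟩,
        ⟨fun t => (hpw t).2.differentiableAt, by simp, by fun_prop⟩⟩
  have hp : ContDiff ℝ (⊤ : ℕ∞) p := contDiff_infty.2 fun n => (hsm n).1
  have hw : ContDiff ℝ (⊤ : ℕ∞) w := contDiff_infty.2 fun n => (hsm n).2
  have hd : deriv (fun x => w x + x * p x) = p := by
    funext t
    have := ((hpw t).2.add ((hasDerivAt_id t).mul (hpw t).1)).deriv
    refine this.trans ?_
    simp only [id]
    ring
  refine ⟨fun x => w x + x * p x, by fun_prop, by simp [hw0], by rw [hd, hp0], fun x _ => ?_⟩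
  rw [hd, (hpw x).1.deriv]
  have : 1 + p x ^ 2 ≠ 0 := by positivity
  field_simp
  ring
end

section
/- Let u : [0, ∞) → ℝ be a twice differentiable solution of u(x) − x·u′(x) = u″(x)/(1 + u′(x)²) with u(0) > 0. Then u(x) − x·u′(x) > 0 for all x ≥ 0; in particular u(x) > x·u′(x) for every x ≥ 0. -/
/-- A solution of the linear equation `w' = -c w` on `[0, ∞)` with continuous coefficient which is
positive at `0` stays positive. -/
theorem pos_of_hasDerivAt_neg_mul {w c : ℝ → ℝ} (hc : Continuous c)
    (hw : ∀ x : ℝ, 0 ≤ x → HasDerivAt w (-(c x * w x)) x) (h0 : 0 < w 0) {x : ℝ} (hx : 0 ≤ x) :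
    0 < w x := by
  have hderiv : ∀ t : ℝ, 0 ≤ t →
      HasDerivAt (fun y => w y * Real.exp (∫ s in (0 : ℝ)..y, c s)) 0 t := by
    intro t ht
    refine ((hw t ht).mul (hc.integral_hasStrictDerivAt 0 t).hasDerivAt.exp).congr_deriv ?_
    ring
  have hconst := constant_of_has_deriv_right_zero
    (fun t ht => (hderiv t ht.1).continuousAt.continuousWithinAt)
    (fun t ht => (hderiv t ht.1).hasDerivWithinAt) x ⟨hx, le_rfl⟩
  simp only [intervalIntegral.integral_same, Real.exp_zero, mul_one] at hconst
  exact pos_of_mul_pos_left (hconst ▸ h0) (Real.exp_pos _).le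

/-- For a twice differentiable solution of the self-expander ODE
on `[0, ∞)` with `u(0) > 0`, the quantity `u - x·u'` is positive everywhere. -/
theorem self_expander_u_sub_xu'_pos
    (u : ℝ → ℝ)
    (hu1 : ∀ x : ℝ, 0 ≤ x → DifferentiableAt ℝ u x)
    (hu2 : ∀ x : ℝ, 0 ≤ x → DifferentiableAt ℝ (deriv u) x)
    (hode : ∀ x : ℝ, 0 ≤ x →
      u x - x * deriv u x = deriv (deriv u) x / (1 + (deriv u x) ^ 2))
    (h0 : 0 < u 0) :
    ∀ x : ℝ, 0 ≤ x → 0 < u x - x * deriv u x := by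
  intro x hx
  have hcont : Continuous fun t : ℝ => deriv u (max t 0) :=
    continuous_iff_continuousAt.2 fun t =>
      ContinuousAt.comp (f := fun t : ℝ => max t 0) (hu2 _ (le_max_right t 0)).continuousAt
        (by fun_prop)
  refine pos_of_hasDerivAt_neg_mul (w := fun y => u y - y * deriv u y)
    (c := fun t => max t 0 * (1 + deriv u (max t 0) ^ 2)) (by fun_prop) ?_ (by simpa using h0) hx
  intro t ht
  have hne : 1 + deriv u t ^ 2 ≠ 0 := by positivity
  have hu'' := (eq_div_iff hne).1 (hode t ht)
  refine ((hu1 t ht).hasDerivAt.sub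
    ((hasDerivAt_id t).mul (hu2 t ht).hasDerivAt)).congr_deriv ?_
  simp only [max_eq_left ht, id, ← hu'']
  ring
end

section
/- Let u : [0, ∞) → ℝ be a twice differentiable solution of u(x) − x·u′(x) = u″(x)/(1 + u′(x)²) with u(0) > 0, and let ε > 0. Then for all x ≥ ε one has 0 < u(x) − x·u′(x) ≤ (u(ε) − ε·u′(ε)) · exp(−ε·(x − ε)). In particular, the quantity u − x·u′ decays exponentially in x. -/
/-- A solution of the scalar linear equation `w' = -a w` on `[0, b]` with `a` bounded above that
starts positive stays positive. -/
theorem pos_of_hasDerivAt_neg_mul_s5 {w a : ℝ → ℝ} {b M : ℝ} (hb : 0 ≤ b)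
    (hw : ∀ x ∈ Set.Icc 0 b, HasDerivAt w (-(a x * w x)) x)
    (ha : ∀ x ∈ Set.Icc 0 b, a x ≤ M) (h0 : 0 < w 0) : 0 < w b := by
  have hcont : ContinuousOn w (Set.Icc 0 b) :=
    fun x hx => (hw x hx).continuousAt.continuousWithinAt
  have hd : ∀ x ∈ Set.Icc 0 b, HasDerivAt (fun y => w y ^ 2 * Real.exp (2 * M * y))
      (2 * (M - a x) * w x ^ 2 * Real.exp (2 * M * x)) x := by
    intro x hx
    have he : HasDerivAt (fun y => Real.exp (2 * M * y)) (Real.exp (2 * M * x) * (2 * M)) x := by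
      simpa using ((hasDerivAt_id x).const_mul (2 * M)).exp
    refine (((hw x hx).pow 2).mul he).congr_deriv ?_
    simp only [Pi.pow_apply]
    push_cast
    ring
  have hmono : MonotoneOn (fun y => w y ^ 2 * Real.exp (2 * M * y)) (Set.Icc 0 b) := by
    refine monotoneOn_of_deriv_nonneg (convex_Icc 0 b)
      (fun x hx => (hd x hx).continuousAt.continuousWithinAt)
      (fun x hx => (hd x (interior_subset hx)).differentiableAt.differentiableWithinAt) ?_
    intro x hx
    rw [(hd x (interior_subset hx)).deriv]
    have := sub_nonneg.2 (ha x (interior_subset hx))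
    positivity
  have hne : ∀ x ∈ Set.Icc 0 b, w x ≠ 0 := by
    intro x hx hx0
    have h := hmono (Set.left_mem_Icc.2 hb) hx hx.1
    simp only [hx0] at h
    norm_num at h
    nlinarith
  by_contra! hneg
  obtain ⟨x, hx, hx0⟩ := intermediate_value_Icc' hb hcont ⟨hneg, h0.le⟩
  exact hne x hx hx0


/-- For a twice differentiable solution of the self-expander ODE
on `[0, ∞)` with `u(0) > 0` and any `ε > 0`, the quantity `u - x·u'` decays
exponentially: for `x ≥ ε`,
`0 < u(x) - x·u'(x) ≤ (u(ε) - ε·u'(ε)) · exp(-ε·(x - ε))`. -/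
theorem self_expander_u_sub_xu'_exp_decay
    (u : ℝ → ℝ)
    (hu1 : ∀ x : ℝ, 0 ≤ x → DifferentiableAt ℝ u x)
    (hu2 : ∀ x : ℝ, 0 ≤ x → DifferentiableAt ℝ (deriv u) x)
    (hode : ∀ x : ℝ, 0 ≤ x →
      u x - x * deriv u x = deriv (deriv u) x / (1 + (deriv u x) ^ 2))
    (h0 : 0 < u 0) (ε : ℝ) (hε : 0 < ε) :
    ∀ x : ℝ, ε ≤ x →
      0 < u x - x * deriv u x ∧
      u x - x * deriv u x ≤ (u ε - ε * deriv u ε) * Real.exp (-ε * (x - ε)) := by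
  have hw : ∀ x : ℝ, 0 ≤ x → HasDerivAt (fun y => u y - y * deriv u y)
      (-((x * (1 + deriv u x ^ 2)) * (u x - x * deriv u x))) x := by
    intro x hx
    refine ((hu1 x hx).hasDerivAt.sub
      ((hasDerivAt_id x).mul (hu2 x hx).hasDerivAt)).congr_deriv ?_
    have hpos : (1 + deriv u x ^ 2) ≠ 0 := by positivity
    have h := (eq_div_iff hpos).1 (hode x hx)
    simp only [id]
    linear_combination x * h
  have hpos : ∀ x : ℝ, 0 ≤ x → 0 < u x - x * deriv u x := by
    intro b hb
    have hcont : ContinuousOn (fun x => x * (1 + deriv u x ^ 2)) (Set.Icc 0 b) := by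
      have hc : ContinuousOn (deriv u) (Set.Icc 0 b) :=
        fun x hx => (hu2 x hx.1).continuousAt.continuousWithinAt
      fun_prop
    obtain ⟨M, hM⟩ := isCompact_Icc.bddAbove_image hcont
    exact pos_of_hasDerivAt_neg_mul_s5 (w := fun y => u y - y * deriv u y) hb
      (fun x hx => hw x hx.1) (fun x hx => hM (Set.mem_image_of_mem _ hx)) (by simpa using h0)
  intro x hx
  refine ⟨hpos x (hε.le.trans hx), ?_⟩
  have hd : ∀ x ∈ Set.Ici ε, HasDerivAt
      (fun y => (u y - y * deriv u y) * Real.exp (ε * (y - ε)))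
      ((ε - x * (1 + deriv u x ^ 2)) * (u x - x * deriv u x) * Real.exp (ε * (x - ε))) x := by
    intro x hx
    have he : HasDerivAt (fun y => Real.exp (ε * (y - ε))) (Real.exp (ε * (x - ε)) * ε) x := by
      simpa using (((hasDerivAt_id x).sub_const ε).const_mul ε).exp
    refine ((hw x (hε.le.trans hx)).mul he).congr_deriv ?_
    ring
  have hanti : AntitoneOn (fun y => (u y - y * deriv u y) * Real.exp (ε * (y - ε)))
      (Set.Ici ε) := by
    refine antitoneOn_of_deriv_nonpos (convex_Ici ε)
      (fun x hx => (hd x hx).continuousAt.continuousWithinAt)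
      (fun x hx => (hd x (interior_subset hx)).differentiableAt.differentiableWithinAt) ?_
    intro x hx
    have hx' : ε ≤ x := interior_subset hx
    rw [(hd x hx').deriv]
    have hcoef : ε - x * (1 + deriv u x ^ 2) ≤ 0 := by
      nlinarith [mul_nonneg (hε.le.trans hx') (sq_nonneg (deriv u x))]
    exact mul_nonpos_of_nonpos_of_nonneg
      (mul_nonpos_of_nonpos_of_nonneg hcoef (hpos x (hε.le.trans hx')).le) (Real.exp_pos _).le
  have h := hanti Set.self_mem_Ici hx hx
  simp only [sub_self, mul_zero, Real.exp_zero, mul_one] at h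
  rw [neg_mul, Real.exp_neg, ← div_eq_mul_inv]
  exact (le_div_iff₀ (Real.exp_pos _)).2 h
end

section
/- Let a ∈ ℝ and let u : [0, ∞) → ℝ be a twice differentiable solution of u(x) − x·u′(x) = u″(x)/(1 + u′(x)²) with u(0) > 0. If u(x₀) = a·x₀ for some x₀ > 0, then u(x) > a·x for all 0 ≤ x < x₀ and u(x) < a·x for all x > x₀. In particular, the graph of u over [0, ∞) intersects each straight line through the origin at most once. -/
/-- The quantity `(u - x u') exp((x² + u²) / 2) / √(1 + u'²)` is stationary along solutions of the
self-expander equation. -/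
lemma hasDerivAt_selfExpander_firstIntegral {u p : ℝ → ℝ} {q x : ℝ}
    (hu : HasDerivAt u (p x) x) (hp : HasDerivAt p q x)
    (hode : u x - x * p x = q / (1 + p x ^ 2)) :
    HasDerivAt (fun y ↦ (u y - y * p y) *
      Real.exp ((y ^ 2 + u y ^ 2) / 2 - Real.log (1 + p y ^ 2) / 2)) 0 x := by
  have hpos : 0 < 1 + p x ^ 2 := by positivity
  have hh := hu.sub ((hasDerivAt_id x).mul hp)
  have hE := (((((hasDerivAt_id x).pow 2).add (hu.pow 2)).div_const 2).sub
    ((((hp.pow 2).const_add 1).log hpos.ne').div_const 2)).exp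
  refine (hh.mul hE).congr_deriv ?_
  have hq : q = (u x - x * p x) * (1 + p x ^ 2) := by
    rw [hode]; field_simp
  subst hq
  simp only [Pi.sub_apply, Pi.mul_apply, Pi.add_apply, Pi.pow_apply, id]
  field_simp
  ring

/-- A self-expander with `u 0 > 0` has all its tangents meeting the vertical axis at positive height. -/
lemma selfExpander_tangent_intercept_pos {u : ℝ → ℝ}
    (hu1 : ∀ x : ℝ, 0 ≤ x → DifferentiableAt ℝ u x)
    (hu2 : ∀ x : ℝ, 0 ≤ x → DifferentiableAt ℝ (deriv u) x)
    (hode : ∀ x : ℝ, 0 ≤ x →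
      u x - x * deriv u x = deriv (deriv u) x / (1 + (deriv u x) ^ 2))
    (h0 : 0 < u 0) {x : ℝ} (hx : 0 ≤ x) : 0 < u x - x * deriv u x := by
  have hd := fun y (hy : 0 ≤ y) ↦ hasDerivAt_selfExpander_firstIntegral
    (hu1 y hy).hasDerivAt (hu2 y hy).hasDerivAt (hode y hy)
  have hconst := constant_of_has_deriv_right_zero (a := 0) (b := x)
    (fun y hy ↦ (hd y hy.1).continuousAt.continuousWithinAt)
    (fun y hy ↦ (hd y hy.1).hasDerivWithinAt) x ⟨hx, le_rfl⟩
  refine pos_of_mul_pos_left (lt_of_lt_of_eq ?_ hconst.symm) (Real.exp_pos _).le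
  rw [zero_mul, sub_zero]
  exact mul_pos h0 (Real.exp_pos _)

/-- If every tangent on `(0, ∞)` has positive intercept, the slope `u x / x` strictly decreases. -/
lemma strictAntiOn_div_self_of_tangent_intercept_pos {u : ℝ → ℝ}
    (hu : ∀ x : ℝ, 0 < x → DifferentiableAt ℝ u x)
    (h : ∀ x : ℝ, 0 < x → 0 < u x - x * deriv u x) :
    StrictAntiOn (fun x ↦ u x / x) (Set.Ioi 0) := by
  have hd : ∀ x : ℝ, 0 < x →
      HasDerivAt (fun x ↦ u x / x) ((deriv u x * x - u x * 1) / x ^ 2) x :=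
    fun x hx ↦ (hu x hx).hasDerivAt.div (hasDerivAt_id x) hx.ne'
  refine strictAntiOn_of_deriv_neg (convex_Ioi 0)
    (fun x hx ↦ (hd x hx).continuousAt.continuousWithinAt) fun x hx ↦ ?_
  rw [interior_Ioi] at hx
  rw [(hd x hx).deriv]
  exact div_neg_of_neg_of_pos (by linarith [h x hx]) (pow_pos hx 2)

/-- A solution of the self-expander ODE on `[0, ∞)` with
`u(0) > 0` crosses each straight line through the origin at most once:
if `u(x₀) = a·x₀` for some `x₀ > 0`, then `u(x) > a·x` for `0 ≤ x < x₀` and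
`u(x) < a·x` for `x > x₀`. -/
theorem self_expander_crosses_lines_once
    (a : ℝ) (u : ℝ → ℝ)
    (hu1 : ∀ x : ℝ, 0 ≤ x → DifferentiableAt ℝ u x)
    (hu2 : ∀ x : ℝ, 0 ≤ x → DifferentiableAt ℝ (deriv u) x)
    (hode : ∀ x : ℝ, 0 ≤ x →
      u x - x * deriv u x = deriv (deriv u) x / (1 + (deriv u x) ^ 2))
    (h0 : 0 < u 0)
    (x₀ : ℝ) (hx₀ : 0 < x₀) (hux₀ : u x₀ = a * x₀) :
    (∀ x : ℝ, 0 ≤ x → x < x₀ → u x > a * x) ∧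
    (∀ x : ℝ, x₀ < x → u x < a * x) := by
  have hanti := strictAntiOn_div_self_of_tangent_intercept_pos (fun x hx ↦ hu1 x hx.le)
    fun x hx ↦ selfExpander_tangent_intercept_pos hu1 hu2 hode h0 hx.le
  have ha : u x₀ / x₀ = a := by rw [hux₀]; field_simp
  refine ⟨fun x hx hlt ↦ ?_, fun x hlt ↦ ?_⟩
  · rcases hx.eq_or_lt with rfl | hx
    · simpa using h0
    · have hslope : u x₀ / x₀ < u x / x := hanti hx hx₀ hlt
      rwa [ha, lt_div_iff₀ hx] at hslope
  · have hx := hx₀.trans hlt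
    have hslope : u x / x < u x₀ / x₀ := hanti hx₀ hx hlt
    rwa [ha, div_lt_iff₀ hx] at hslope
end

section
/- Let u : [0, ∞) → ℝ be a twice differentiable solution of u(x) − x·u′(x) = u″(x)/(1 + u′(x)²) with u(0) > 0. Then there exist a ∈ ℝ and constants C > 0, δ > 0 such that |u(x) − a·x| ≤ C·exp(−δ·x) and |u′(x) − a| ≤ C·exp(−δ·x) for all x ≥ 0; in particular u′(x) → a and u(x)/x → a as x → ∞, and the graph of u is asymptotic at infinity to the straight line y = a·x through the origin, with exponential convergence. -/
open Filter

/-- A function with nonpositive derivative on `[b, ∞)` is antitone there. -/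
theorem antitoneOn_Ici_of_hasDerivAt_nonpos {f f' : ℝ → ℝ} {b : ℝ}
    (hf : ∀ x, b ≤ x → HasDerivAt f (f' x) x) (hf' : ∀ x, b ≤ x → f' x ≤ 0) :
    AntitoneOn f (Set.Ici b) := by
  refine antitoneOn_of_hasDerivWithinAt_nonpos (f' := f') (convex_Ici b)
    (fun x hx => (hf x hx).continuousAt.continuousWithinAt)
    (fun x hx => (hf x (interior_subset hx)).hasDerivWithinAt)
    (fun x hx => hf' x (interior_subset hx))

section SelfExpander

variable {p w : ℝ → ℝ}

/-- Gaussian decay of the square of `w`, where `p = u'` and `w = u - x u'`. -/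
theorem antitoneOn_sq_mul_exp_sq
    (hw : ∀ x, 0 ≤ x → HasDerivAt w (-x * (w x * (1 + p x ^ 2))) x) :
    AntitoneOn (fun x => w x ^ 2 * Real.exp (x ^ 2)) (Set.Ici 0) := by
  refine antitoneOn_Ici_of_hasDerivAt_nonpos
    (fun x hx => ((hw x hx).pow 2).mul (((hasDerivAt_id x).pow 2).exp)) fun x hx => ?_
  have key : 0 ≤ 2 * x * (w x ^ 2 * p x ^ 2) * Real.exp (x ^ 2) := by positivity
  simp only [id, Pi.pow_apply, Nat.cast_ofNat]
  norm_num
  linarith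

theorem nonneg_of_hasDerivAt
    (hw : ∀ x, 0 ≤ x → HasDerivAt w (-x * (w x * (1 + p x ^ 2))) x) (h0 : 0 < w 0)
    {x : ℝ} (hx : 0 ≤ x) : 0 ≤ w x := by
  by_contra! hneg
  obtain ⟨c, hc, hwc⟩ : (0 : ℝ) ∈ w '' Set.Icc 0 x :=
    intermediate_value_Icc' hx
      (fun y hy => (hw y hy.1).continuousAt.continuousWithinAt) ⟨hneg.le, h0.le⟩
  have h := antitoneOn_sq_mul_exp_sq hw hc.1 hx hc.2
  have hpos : 0 < w x ^ 2 * Real.exp (x ^ 2) := mul_pos (by nlinarith) (Real.exp_pos _)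
  simp only [hwc] at h
  linarith

theorem le_mul_exp_neg
    (hw : ∀ x, 0 ≤ x → HasDerivAt w (-x * (w x * (1 + p x ^ 2))) x) (h0 : 0 < w 0)
    {x : ℝ} (hx : 0 ≤ x) : w x ≤ w 0 * Real.exp (1 - x) := by
  have h := antitoneOn_sq_mul_exp_sq hw Set.self_mem_Ici hx hx
  simp only [ne_eq, OfNat.ofNat_ne_zero, not_false_eq_true, zero_pow, Real.exp_zero,
    mul_one] at h
  refine le_of_sq_le_sq ?_ (by positivity)
  have hexp : Real.exp (-x ^ 2) ≤ Real.exp (1 - x) ^ 2 := by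
    rw [← Real.exp_nat_mul, Real.exp_le_exp]
    push_cast
    nlinarith [sq_nonneg (x - 1)]
  calc w x ^ 2 = w x ^ 2 * Real.exp (x ^ 2) * Real.exp (-x ^ 2) := by
        rw [mul_assoc, ← Real.exp_add]; simp
    _ ≤ w 0 ^ 2 * Real.exp (1 - x) ^ 2 := by gcongr
    _ = (w 0 * Real.exp (1 - x)) ^ 2 := by ring

/-- The slope `p` increases to a finite limit `a`, at a rate controlled by `w`. -/
theorem exists_slope_bounds
    (hp : ∀ x, 0 ≤ x → HasDerivAt p (w x * (1 + p x ^ 2)) x)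
    (hw : ∀ x, 0 ≤ x → HasDerivAt w (-x * (w x * (1 + p x ^ 2))) x) (h0 : 0 < w 0) :
    ∃ a, ∀ x, 0 ≤ x → p 0 ≤ p x ∧ p x ≤ a ∧ x * (a - p x) ≤ w x := by
  have hw0 : ∀ x, 0 ≤ x → 0 ≤ w x := fun x hx => nonneg_of_hasDerivAt hw h0 hx
  have hp' : ∀ x, 0 ≤ x → 0 ≤ w x * (1 + p x ^ 2) := fun x hx =>
    mul_nonneg (hw0 x hx) (by positivity)
  have hmono : ∀ x y, 0 ≤ x → x ≤ y → p x ≤ p y := fun x y hx hxy =>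
    neg_le_neg_iff.1 <| antitoneOn_Ici_of_hasDerivAt_nonpos (b := 0)
      (fun z hz => (hp z hz).fun_neg) (fun z hz => neg_nonpos.2 (hp' z hz)) hx (hx.trans hxy) hxy
  have hdiff : ∀ x y, 0 ≤ x → 0 ≤ y → x * (p y - p x) ≤ w x := by
    intro x y hx hy
    rcases le_total x y with hxy | hxy
    · have h := antitoneOn_Ici_of_hasDerivAt_nonpos (b := x)
        (fun z hz => ((hp z (hx.trans hz)).const_mul x).fun_add (hw z (hx.trans hz)))
        (fun z hz => by nlinarith [mul_nonneg (sub_nonneg.2 hz) (hp' z (hx.trans hz))])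
        Set.self_mem_Ici hxy hxy
      simp only at h
      linarith [hw0 y hy]
    · exact (mul_nonpos_of_nonneg_of_nonpos hx (sub_nonpos.2 (hmono y x hy hxy))).trans (hw0 x hx)
  have hbound : ∀ x, 0 < x → ∀ z ∈ p '' Set.Ici 0, z ≤ p x + w x / x := by
    rintro x hx _ ⟨y, hy, rfl⟩
    rw [← sub_le_iff_le_add', le_div_iff₀' hx]
    exact hdiff x y hx.le hy
  refine ⟨sSup (p '' Set.Ici 0), fun x hx => ⟨hmono 0 x le_rfl hx,
    le_csSup ⟨_, hbound 1 one_pos⟩ ⟨x, hx, rfl⟩, ?_⟩⟩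
  rcases hx.eq_or_lt with rfl | hx
  · simpa using h0.le
  · rw [← le_div_iff₀' hx, sub_le_iff_le_add']
    exact csSup_le ⟨_, x, hx.le, rfl⟩ (hbound x hx)

end SelfExpander

theorem tendsto_of_abs_sub_le_exp {f : ℝ → ℝ} {a C δ : ℝ} (hδ : 0 < δ)
    (h : ∀ᶠ x in atTop, |f x - a| ≤ C * Real.exp (-δ * x)) : Tendsto f atTop (nhds a) := by
  rw [tendsto_iff_norm_sub_tendsto_zero]
  refine squeeze_zero' (Eventually.of_forall fun _ => norm_nonneg _) h ?_
  have hexp : Tendsto (fun x : ℝ => Real.exp (-δ * x)) atTop (nhds 0) :=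
    Real.tendsto_exp_atBot.comp (tendsto_id.const_mul_atTop_of_neg (neg_neg_of_pos hδ))
  simpa using hexp.const_mul C

/-- A twice differentiable solution of the self-expander ODE on
`[0, ∞)` with `u(0) > 0` converges exponentially to a straight line `y = a·x`
through the origin: there are `a ∈ ℝ`, `C > 0`, `δ > 0` with
`|u(x) - a·x| ≤ C·exp(-δ·x)` and `|u'(x) - a| ≤ C·exp(-δ·x)` for `x ≥ 0`;
in particular `u'(x) → a` and `u(x)/x → a` as `x → ∞`. -/
theorem self_expander_asymptotic_line
    (u : ℝ → ℝ)
    (hu1 : ∀ x : ℝ, 0 ≤ x → DifferentiableAt ℝ u x)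
    (hu2 : ∀ x : ℝ, 0 ≤ x → DifferentiableAt ℝ (deriv u) x)
    (hode : ∀ x : ℝ, 0 ≤ x →
      u x - x * deriv u x = deriv (deriv u) x / (1 + (deriv u x) ^ 2))
    (h0 : 0 < u 0) :
    ∃ a C δ : ℝ, 0 < C ∧ 0 < δ ∧
      (∀ x : ℝ, 0 ≤ x → |u x - a * x| ≤ C * Real.exp (-δ * x)) ∧
      (∀ x : ℝ, 0 ≤ x → |deriv u x - a| ≤ C * Real.exp (-δ * x)) ∧
      Tendsto (deriv u) atTop (nhds a) ∧
      Tendsto (fun x => u x / x) atTop (nhds a) := by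
  have hp : ∀ x, 0 ≤ x →
      HasDerivAt (deriv u) ((u x - x * deriv u x) * (1 + deriv u x ^ 2)) x := by
    intro x hx
    have hne : 1 + deriv u x ^ 2 ≠ 0 := by positivity
    rw [(eq_div_iff hne).1 (hode x hx)]
    exact (hu2 x hx).hasDerivAt
  have hw : ∀ x, 0 ≤ x → HasDerivAt (fun x => u x - x * deriv u x)
      (-x * ((u x - x * deriv u x) * (1 + deriv u x ^ 2))) x := by
    intro x hx
    exact ((hu1 x hx).hasDerivAt.fun_sub ((hasDerivAt_id' x).fun_mul (hp x hx))).congr_deriv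
      (by ring)
  have hw0 : 0 < u 0 - 0 * deriv u 0 := by simpa using h0
  obtain ⟨a, ha⟩ := exists_slope_bounds hp hw hw0
  have hdecay := fun x (hx : 0 ≤ x) => le_mul_exp_neg hw hw0 hx
  simp only [zero_mul, sub_zero] at hdecay
  have hslope : 0 ≤ a - deriv u 0 := sub_nonneg.2 (ha 0 le_rfl).2.1
  have hexp : ∀ x, (u 0 + (a - deriv u 0)) * Real.exp 1 * Real.exp (-1 * x)
      = u 0 * Real.exp (1 - x) + (a - deriv u 0) * Real.exp (1 - x) := by
    intro x
    rw [mul_assoc, ← Real.exp_add, ← add_mul]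
    ring_nf
  have hu : ∀ x, 0 ≤ x →
      |u x - a * x| ≤ (u 0 + (a - deriv u 0)) * Real.exp 1 * Real.exp (-1 * x) := by
    intro x hx
    obtain ⟨-, hle, hrate⟩ := ha x hx
    have hnn := mul_nonneg hx (sub_nonneg.2 hle)
    have hmul := mul_nonneg hslope (Real.exp_pos (1 - x)).le
    rw [hexp, abs_of_nonneg (by linarith)]
    linarith [hdecay x hx]
  have hu' : ∀ x, 0 ≤ x →
      |deriv u x - a| ≤ (u 0 + (a - deriv u 0)) * Real.exp 1 * Real.exp (-1 * x) := by
    intro x hx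
    obtain ⟨hge, hle, hrate⟩ := ha x hx
    rw [hexp, abs_sub_comm, abs_of_nonneg (sub_nonneg.2 hle)]
    rcases le_total x 1 with h1 | h1
    · have hone : 1 ≤ Real.exp (1 - x) := Real.one_le_exp (sub_nonneg.2 h1)
      have hmul := mul_pos h0 (Real.exp_pos (1 - x))
      linarith [le_mul_of_one_le_right hslope hone]
    · have hmul := mul_nonneg hslope (Real.exp_pos (1 - x)).le
      linarith [hdecay x hx, le_mul_of_one_le_left (sub_nonneg.2 hle) h1]
  have hquot : ∀ x, 1 ≤ x →
      |u x / x - a| ≤ (u 0 + (a - deriv u 0)) * Real.exp 1 * Real.exp (-1 * x) := by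
    intro x hx
    have hx0 : 0 < x := one_pos.trans_le hx
    refine le_trans ?_ (hu x hx0.le)
    rw [div_sub' hx0.ne', abs_div, abs_of_pos hx0, mul_comm x a]
    exact div_le_self (abs_nonneg _) hx
  exact ⟨a, _, 1, mul_pos (by linarith) (Real.exp_pos 1), one_pos, hu, hu',
    tendsto_of_abs_sub_le_exp one_pos (eventually_atTop.2 ⟨0, hu'⟩),
    tendsto_of_abs_sub_le_exp one_pos (eventually_atTop.2 ⟨1, hquot⟩)⟩
end

section
/- Let u, v : [0, ∞) → ℝ be twice differentiable solutions of w(x) − x·w′(x) = w″(x)/(1 + w′(x)²) with u(0) > v(0) > 0 and u′(0) = v′(0). Then u(x) − v(x) > 0 for all x ≥ 0, and the difference u − v is strictly increasing on [0, ∞). -/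
/-- If `w` has first and second derivatives `dw`, `ddw`, with `dw 0 = 0`, `w 0 > 0`,
and `ddw x > 0` whenever `dw x = 0` and `w x > 0`, then `dw` is positive on `(0, ∞)`. -/
theorem pos_of_deriv_pos_at_critical (w dw ddw : ℝ → ℝ)
    (hw : ∀ x, 0 ≤ x → HasDerivAt w (dw x) x)
    (hdw : ∀ x, 0 ≤ x → HasDerivAt dw (ddw x) x)
    (hcrit : ∀ x, 0 ≤ x → dw x = 0 → 0 < w x → 0 < ddw x)
    (h0 : dw 0 = 0) (hpos : 0 < w 0) (b : ℝ) (hb : 0 < b) : 0 < dw b := by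
  by_contra! hneg
  have sign_near : ∀ x, 0 ≤ x → dw x = 0 → 0 < w x →
      ∀ᶠ y in nhds x, SignType.sign (dw y) = SignType.sign (y - x) := by
    intro x hx hx0 hwx
    refine eventually_nhdsWithin_sign_eq_of_deriv_pos ?_ hx0
    rw [(hdw x hx).deriv]
    exact hcrit x hx hx0 hwx
  obtain ⟨δ, hδ, hδpos⟩ := Metric.eventually_nhds_iff.1 (sign_near 0 le_rfl h0 hpos)
  have near_zero : ∀ y, 0 < y → y < δ → 0 < dw y := by
    intro y hy hyδ
    have h := hδpos (y := y) (by rwa [Real.dist_eq, sub_zero, abs_of_pos hy])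
    rw [sub_zero, sign_pos hy] at h
    exact sign_eq_one_iff.1 h
  have hδb : δ ≤ b := le_of_not_gt fun h => (near_zero b hb h).not_ge hneg
  have hcont : ContinuousOn dw (Set.Icc δ b) := fun x hx =>
    (hdw x (hδ.le.trans hx.1)).continuousAt.continuousWithinAt
  obtain ⟨s, ⟨⟨hδs, hsb⟩, hs⟩, hmin⟩ :=
    (isCompact_Icc.of_isClosed_subset
      (hcont.preimage_isClosed_of_isClosed isClosed_Icc isClosed_Iic)
      Set.inter_subset_left).exists_isLeast ⟨b, ⟨hδb, le_rfl⟩, hneg⟩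
  have hspos : 0 < s := hδ.trans_le hδs
  have before : ∀ y, 0 < y → y < s → 0 < dw y := by
    intro y hy hys
    rcases lt_or_ge y δ with h | h
    · exact near_zero y hy h
    · by_contra! hc
      exact (hmin ⟨⟨h, hys.le.trans hsb⟩, hc⟩).not_gt hys
  have left : ∀ᶠ y in nhdsWithin s (Set.Iio s), 0 < dw y := by
    filter_upwards [Ioo_mem_nhdsLT hspos] with y hy using before y hy.1 hy.2
  have hs0 : dw s = 0 := le_antisymm hs <|
    ge_of_tendsto ((hdw s hspos.le).continuousAt.tendsto.mono_left nhdsWithin_le_nhds)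
      (left.mono fun _ h => h.le)
  have hmono : StrictMonoOn w (Set.Icc 0 s) := by
    refine strictMonoOn_of_deriv_pos (convex_Icc 0 s)
      (fun x hx => (hw x hx.1).continuousAt.continuousWithinAt) fun x hx => ?_
    rw [interior_Icc] at hx
    rw [(hw x hx.1.le).deriv]
    exact before x hx.1 hx.2
  have hws : 0 < w s :=
    hpos.trans (hmono (Set.left_mem_Icc.2 hspos.le) (Set.right_mem_Icc.2 hspos.le) hspos)
  obtain ⟨y, hy, hsign, hys⟩ := (left.and
    (((sign_near s hspos.le hs0 hws).filter_mono nhdsWithin_le_nhds).and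
      self_mem_nhdsWithin)).exists
  rw [sign_pos hy, sign_neg (sub_neg.2 hys)] at hsign
  exact absurd hsign (by decide)

/-- For two solutions of the self-expander ODE with the same
initial slope and `u(0) > v(0) > 0`, the difference `u - v` is everywhere
positive and strictly increasing on `[0, ∞)`. -/
theorem self_expander_height_monotonicity
    (u v : ℝ → ℝ)
    (hu1 : ∀ x : ℝ, 0 ≤ x → DifferentiableAt ℝ u x)
    (hu2 : ∀ x : ℝ, 0 ≤ x → DifferentiableAt ℝ (deriv u) x)
    (hodeu : ∀ x : ℝ, 0 ≤ x →
      u x - x * deriv u x = deriv (deriv u) x / (1 + (deriv u x) ^ 2))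
    (hv1 : ∀ x : ℝ, 0 ≤ x → DifferentiableAt ℝ v x)
    (hv2 : ∀ x : ℝ, 0 ≤ x → DifferentiableAt ℝ (deriv v) x)
    (hodev : ∀ x : ℝ, 0 ≤ x →
      v x - x * deriv v x = deriv (deriv v) x / (1 + (deriv v x) ^ 2))
    (hv0 : 0 < v 0) (huv0 : v 0 < u 0) (hslope : deriv u 0 = deriv v 0) :
    (∀ x : ℝ, 0 ≤ x → 0 < u x - v x) ∧
    StrictMonoOn (fun x => u x - v x) (Set.Ici (0 : ℝ)) := by
  have hw : ∀ x, 0 ≤ x → HasDerivAt (fun x => u x - v x) (deriv u x - deriv v x) x :=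
    fun x hx => (hu1 x hx).hasDerivAt.sub (hv1 x hx).hasDerivAt
  have hcrit : ∀ x, 0 ≤ x → deriv u x - deriv v x = 0 → 0 < u x - v x →
      0 < deriv (deriv u) x - deriv (deriv v) x := by
    intro x hx hx0 hwx
    have hp : (0 : ℝ) < 1 + deriv v x ^ 2 := by positivity
    have hu := hodeu x hx
    have hv := hodev x hx
    rw [sub_eq_zero.1 hx0, eq_div_iff hp.ne'] at hu
    rw [eq_div_iff hp.ne'] at hv
    rw [← hu, ← hv]
    linarith [mul_pos hwx hp]
  have hdpos := pos_of_deriv_pos_at_critical _ _ _ hw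
    (fun x hx => (hu2 x hx).hasDerivAt.sub (hv2 x hx).hasDerivAt) hcrit
    (sub_eq_zero.2 hslope) (sub_pos.2 huv0)
  have hmono : StrictMonoOn (fun x => u x - v x) (Set.Ici (0 : ℝ)) := by
    refine strictMonoOn_of_deriv_pos (convex_Ici 0)
      (fun x hx => (hw x hx).continuousAt.continuousWithinAt) fun x hx => ?_
    rw [interior_Ici] at hx
    rw [(hw x (le_of_lt hx)).deriv]
    exact hdpos x hx
  exact ⟨fun x hx => (sub_pos.2 huv0).trans_le
    (hmono.monotoneOn Set.self_mem_Ici hx hx), hmono⟩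
end

section
/- Let u, v : [0, ∞) → ℝ be twice differentiable solutions of w(x) − x·w′(x) = w″(x)/(1 + w′(x)²) with u(0) = v(0) > 0 and u′(0) > v′(0). Then u(x) − v(x) > 0 for all x > 0, and the difference u − v is strictly increasing on [0, ∞). -/
/-- For two solutions of the self-expander ODE with the same
initial height `u(0) = v(0) > 0` and `u'(0) > v'(0)`, the difference `u - v`
is positive for `x > 0` and strictly increasing on `[0, ∞)`. -/
theorem self_expander_slope_monotonicity
    (u v : ℝ → ℝ)
    (hu1 : ∀ x : ℝ, 0 ≤ x → DifferentiableAt ℝ u x)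
    (hu2 : ∀ x : ℝ, 0 ≤ x → DifferentiableAt ℝ (deriv u) x)
    (hodeu : ∀ x : ℝ, 0 ≤ x →
      u x - x * deriv u x = deriv (deriv u) x / (1 + (deriv u x) ^ 2))
    (hv1 : ∀ x : ℝ, 0 ≤ x → DifferentiableAt ℝ v x)
    (hv2 : ∀ x : ℝ, 0 ≤ x → DifferentiableAt ℝ (deriv v) x)
    (hodev : ∀ x : ℝ, 0 ≤ x →
      v x - x * deriv v x = deriv (deriv v) x / (1 + (deriv v x) ^ 2))
    (hv0 : 0 < v 0) (h00 : u 0 = v 0) (hslope : deriv v 0 < deriv u 0) :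
    (∀ x : ℝ, 0 < x → 0 < u x - v x) ∧
    StrictMonoOn (fun x => u x - v x) (Set.Ici (0 : ℝ)) := by
  have hd1 : ∀ x : ℝ, 0 ≤ x →
      HasDerivAt (fun y => u y - v y) (deriv u x - deriv v x) x := fun x hx =>
    (hu1 x hx).hasDerivAt.sub (hv1 x hx).hasDerivAt
  have hd2 : ∀ x : ℝ, 0 ≤ x → HasDerivAt (fun y => deriv u y - deriv v y)
      (deriv (deriv u) x - deriv (deriv v) x) x := fun x hx =>
    (hu2 x hx).hasDerivAt.sub (hv2 x hx).hasDerivAt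
  have hmono : ∀ D ⊆ Set.Ici (0 : ℝ), Convex ℝ D →
      (∀ x ∈ interior D, 0 < deriv u x - deriv v x) →
      StrictMonoOn (fun x => u x - v x) D := fun D hD hconv hpos =>
    strictMonoOn_of_deriv_pos hconv
      (fun x hx => (hd1 x (hD hx)).continuousAt.continuousWithinAt)
      (fun x hx => (hd1 x (hD (interior_subset hx))).deriv.symm ▸ hpos x hx)
  have hpos : ∀ x : ℝ, 0 ≤ x → 0 < deriv u x - deriv v x := by
    by_contra! hneg
    obtain ⟨y, hy0, hy⟩ := hneg
    have hcont : ContinuousOn (fun x => deriv u x - deriv v x) (Set.Icc 0 y) := fun x hx =>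
      (hd2 x hx.1).continuousAt.continuousWithinAt
    have hcomp : IsCompact
        (Set.Icc 0 y ∩ (fun x => deriv u x - deriv v x) ⁻¹' Set.Iic 0) :=
      isCompact_Icc.of_isClosed_subset
        (hcont.preimage_isClosed_of_isClosed isClosed_Icc isClosed_Iic) Set.inter_subset_left
    obtain ⟨c, ⟨⟨hc0, hcy⟩, hc⟩, hmin⟩ := hcomp.exists_isLeast ⟨y, ⟨hy0, le_rfl⟩, hy⟩
    simp only [Set.mem_preimage, Set.mem_Iic] at hc
    have hcpos : 0 < c := by
      refine lt_of_le_of_ne hc0 ?_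
      rintro rfl
      linarith
    have hbefore : ∀ x, 0 ≤ x → x < c → 0 < deriv u x - deriv v x := by
      intro x hx hxc
      by_contra! h
      exact hxc.not_ge (hmin ⟨⟨hx, hxc.le.trans hcy⟩, h⟩)
    have hev : ∀ᶠ x in nhdsWithin c (Set.Iio c), 0 < deriv u x - deriv v x := by
      filter_upwards [Ioo_mem_nhdsLT hcpos] with x hx
      exact hbefore x hx.1.le hx.2
    have hczero : deriv u c - deriv v c = 0 :=
      le_antisymm hc (ge_of_tendsto ((hd2 c hc0).continuousAt.mono_left nhdsWithin_le_nhds)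
        (hev.mono fun _ h => h.le))
    have hdc : 0 < u c - v c := by
      have h := hmono (Set.Icc 0 c) (fun x hx => hx.1) (convex_Icc 0 c)
        (fun x hx => by
          rw [interior_Icc] at hx
          exact hbefore x hx.1.le hx.2)
        (Set.left_mem_Icc.2 hc0) (Set.right_mem_Icc.2 hc0) hcpos
      simp only at h
      linarith
    have hsecond : 0 < deriv (deriv u) c - deriv (deriv v) c := by
      have hu := hodeu c hc0
      have hv := hodev c hc0
      rw [sub_eq_zero.1 hczero] at hu
      have hp : 0 < 1 + deriv v c ^ 2 := by positivity
      rw [eq_div_iff hp.ne'] at hu hv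
      nlinarith [mul_pos hdc hp]
    have hslopes := ((hasDerivAt_iff_tendsto_slope.1 (hd2 c hc0)).mono_left
      (nhdsWithin_mono c (fun x hx => ne_of_lt hx : Set.Iio c ⊆ {c}ᶜ))).eventually_const_lt hsecond
    obtain ⟨x, ⟨hxs, hx⟩, hxc⟩ := ((hslopes.and hev).and self_mem_nhdsWithin).exists
    rw [slope_def_field, hczero, sub_zero] at hxs
    exact hxs.not_ge (div_nonpos_of_nonneg_of_nonpos hx.le (sub_nonpos.2 (le_of_lt hxc)))
  have hstrict := hmono (Set.Ici 0) subset_rfl (convex_Ici 0)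
    fun x hx => hpos x (interior_subset hx)
  refine ⟨fun x hx => ?_, hstrict⟩
  have h := hstrict Set.self_mem_Ici hx.le hx
  simp only at h
  linarith
end

section
/- For every a > 0 and every μ > 0 there exists h > 0 such that every twice differentiable solution u : [0, ∞) → ℝ of u(x) − x·u′(x) = u″(x)/(1 + u′(x)²) with u(0) ≥ h whose derivative u′(x) converges as x → ∞ to a limit at most a must satisfy u′(0) ≤ −μ. That is, a solution starting at large height whose asymptotic slope is bounded above must start with very negative slope. -/
open Filter

/-- A solution of `w' = -x q(x) w` that is positive at `0`, with `q ≤ K` on `[0, b]`, is bounded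
below on `[0, b]` by the Gaussian `w(0) exp (-K x² / 2)`. -/
theorem gaussian_le_of_hasDerivAt {q w : ℝ → ℝ} {K b : ℝ}
    (hw : ∀ x, 0 ≤ x → HasDerivAt w (-x * q x * w x) x) (h0 : 0 < w 0)
    (hq : ∀ x ∈ Set.Icc 0 b, q x ≤ K) {x : ℝ} (hx : x ∈ Set.Icc 0 b) :
    w 0 * Real.exp (-(K * x ^ 2 / 2)) ≤ w x := by
  have hd : ∀ y, 0 ≤ y → HasDerivAt (fun y => w y ^ 2 * Real.exp (K * y ^ 2))
      (2 * y * w y ^ 2 * Real.exp (K * y ^ 2) * (K - q y)) y := by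
    intro y hy
    have h := ((hw y hy).pow 2).mul (((hasDerivAt_pow 2 y).const_mul K).exp)
    refine h.congr_deriv ?_
    simp only [Pi.pow_apply]
    push_cast
    ring
  have hmono : MonotoneOn (fun y => w y ^ 2 * Real.exp (K * y ^ 2)) (Set.Icc 0 b) := by
    refine monotoneOn_of_hasDerivWithinAt_nonneg (convex_Icc 0 b)
      (fun y hy => (hd y hy.1).continuousAt.continuousWithinAt)
      (fun y hy => (hd y (interior_subset hy).1).hasDerivWithinAt) fun y hy => ?_
    have hy' := interior_subset hy
    have h1 := hy'.1
    have h2 : 0 ≤ K - q y := sub_nonneg.2 (hq y hy')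
    positivity
  have hsq : ∀ y ∈ Set.Icc 0 b, w 0 ^ 2 ≤ w y ^ 2 * Real.exp (K * y ^ 2) := by
    intro y hy
    simpa using hmono ⟨le_rfl, hy.1.trans hy.2⟩ hy hy.1
  have hpos : 0 < w x := by
    by_contra! hneg
    obtain ⟨c, hc, hc0⟩ := intermediate_value_Icc' hx.1
      (fun y hy => (hw y hy.1).continuousAt.continuousWithinAt) ⟨hneg, h0.le⟩
    have h := hsq c ⟨hc.1, hc.2.trans hx.2⟩
    rw [hc0] at h
    nlinarith [pow_pos h0 2]
  refine le_of_sq_le_sq ?_ hpos.le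
  have hexp : Real.exp (-(K * x ^ 2 / 2)) ^ 2 * Real.exp (K * x ^ 2) = 1 := by
    rw [← Real.exp_nat_mul, ← Real.exp_add]
    simp
    ring
  refine le_of_mul_le_mul_right ?_ (Real.exp_pos (K * x ^ 2))
  rw [mul_pow, mul_assoc, hexp, mul_one]
  exact hsq x hx

/-- For every `a > 0` and `μ > 0` there is a height `h` such that
every solution of the self-expander ODE with `u(0) ≥ h` whose slope `u'(x)`
converges, as `x → ∞`, to a limit at most `a`, must start with slope
`u'(0) ≤ -μ`. -/
theorem self_expander_points_inside (a μ : ℝ) (ha : 0 < a) (hμ : 0 < μ) :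
    ∃ h : ℝ, 0 < h ∧
      ∀ u : ℝ → ℝ,
        (∀ x : ℝ, 0 ≤ x → DifferentiableAt ℝ u x) →
        (∀ x : ℝ, 0 ≤ x → DifferentiableAt ℝ (deriv u) x) →
        (∀ x : ℝ, 0 ≤ x →
          u x - x * deriv u x = deriv (deriv u) x / (1 + (deriv u x) ^ 2)) →
        h ≤ u 0 →
        (∃ L : ℝ, Tendsto (deriv u) atTop (nhds L) ∧ L ≤ a) →
        deriv u 0 ≤ -μ := by
  set K : ℝ := 1 + (a + μ) ^ 2
  refine ⟨(a + μ + 1) * Real.exp (K / 2), by positivity, ?_⟩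
  rintro u hu hu' hode hh ⟨L, hL, hLa⟩
  by_contra! hslope
  have h0 : 0 < u 0 := lt_of_lt_of_le (by positivity) hh
  set w : ℝ → ℝ := fun x => u x - x * deriv u x with hw_def
  have hw0 : w 0 = u 0 := by simp [hw_def]
  have hu'' : ∀ x, 0 ≤ x → deriv (deriv u) x = (1 + deriv u x ^ 2) * w x := by
    intro x hx
    simp only [hw_def]
    rw [hode x hx]
    have : 1 + deriv u x ^ 2 ≠ 0 := by positivity
    field_simp
  have hw : ∀ x, 0 ≤ x → HasDerivAt w (-x * (1 + deriv u x ^ 2) * w x) x := by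
    intro x hx
    have h := (hu x hx).hasDerivAt.sub ((hasDerivAt_id x).mul (hu' x hx).hasDerivAt)
    refine h.congr_deriv ?_
    rw [hu'' x hx]
    simp only [id]
    ring
  have hcont : ContinuousOn (deriv u) (Set.Ici 0) :=
    fun x hx => (hu' x hx).continuousAt.continuousWithinAt
  have hwpos : ∀ x, 0 ≤ x → 0 < w x := by
    intro x hx
    obtain ⟨C, hC⟩ := isCompact_Icc.bddAbove_image
      ((hcont.mono Set.Icc_subset_Ici_self).pow 2 : ContinuousOn _ (Set.Icc 0 x))
    refine lt_of_lt_of_le ?_ (gaussian_le_of_hasDerivAt (K := 1 + C) hw (hw0 ▸ h0)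
      (fun y hy => by simpa using hC (Set.mem_image_of_mem _ hy)) ⟨hx, le_rfl⟩)
    rw [hw0]
    positivity
  have hmono : MonotoneOn (deriv u) (Set.Ici 0) := by
    refine monotoneOn_of_deriv_nonneg (convex_Ici 0) hcont
      (fun x hx => (hu' x (interior_subset hx)).differentiableWithinAt) fun x hx => ?_
    have hx' : 0 ≤ x := interior_subset hx
    rw [hu'' x hx']
    have := hwpos x hx'
    positivity
  have hle : ∀ x, 0 ≤ x → deriv u x ≤ a := fun x hx =>
    (ge_of_tendsto hL ((eventually_ge_atTop x).mono fun y hy =>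
      hmono hx (hx.trans hy) hy)).trans hLa
  have hge : ∀ x, 0 ≤ x → -μ ≤ deriv u x := fun x hx =>
    hslope.le.trans (hmono Set.self_mem_Ici hx hx)
  have hK : ∀ x, 0 ≤ x → 1 + deriv u x ^ 2 ≤ K := by
    intro x hx
    have h1 := hle x hx
    have h2 := hge x hx
    have := sq_le_sq' (by linarith : -(a + μ) ≤ deriv u x) (by linarith)
    simp only [K]
    linarith
  have hlow : ∀ x ∈ Set.Icc (0 : ℝ) 1, a + μ + 1 ≤ deriv (deriv u) x := by
    intro x hx
    have hg := gaussian_le_of_hasDerivAt hw (hw0 ▸ h0) (fun y hy => hK y hy.1) hx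
    have hKpos : 0 < K := by positivity
    have hx2 : K * x ^ 2 / 2 ≤ K / 2 := by
      have := pow_le_one₀ (n := 2) hx.1 hx.2
      nlinarith
    have he : a + μ + 1 ≤ u 0 * Real.exp (-(K * x ^ 2 / 2)) := by
      calc a + μ + 1 = (a + μ + 1) * Real.exp (K / 2) * Real.exp (-(K / 2)) := by
            rw [mul_assoc, ← Real.exp_add, add_neg_cancel, Real.exp_zero, mul_one]
        _ ≤ u 0 * Real.exp (-(K * x ^ 2 / 2)) := by gcongr
    rw [hw0] at hg
    rw [hu'' x hx.1]
    nlinarith [hwpos x hx.1, mul_nonneg (sq_nonneg (deriv u x)) (hwpos x hx.1).le]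
  obtain ⟨c, hc, hc'⟩ := exists_deriv_eq_slope (deriv u) zero_lt_one
    (hcont.mono Set.Icc_subset_Ici_self)
    (fun x hx => (hu' x hx.1.le).differentiableWithinAt)
  have h1 := hlow c ⟨hc.1.le, hc.2.le⟩
  have h2 := hle 1 zero_le_one
  rw [hc', sub_zero, div_one] at h1
  linarith
end

section
/- For every a > 0 there exists h > 0 such that the twice differentiable solution u : [0, ∞) → ℝ of u(x) − x·u′(x) = u″(x)/(1 + u′(x)²) with u(0) = h and u′(0) = 0 satisfies lim_{x→∞} (u(x) − a·x) = 0; i.e. its graph is asymptotic at infinity to the half-line {(x, a·x) : x ≥ 0}. -/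
open Filter

/-- The self-expander ODE in the variables `s = u - x u'` and `p = u'`, on the half-line `x ≥ 0`,
with initial data `s 0 = h` and `p 0 = 0`. -/
structure IsExpanderPair (h : ℝ) (s p : ℝ → ℝ) : Prop where
  s_zero : s 0 = h
  p_zero : p 0 = 0
  hasDerivAt_s : ∀ x, 0 ≤ x → HasDerivAt s (-(x * (s x * (1 + p x ^ 2)))) x
  hasDerivAt_p : ∀ x, 0 ≤ x → HasDerivAt p (s x * (1 + p x ^ 2)) x

theorem monotoneOn_Ici_of_hasDerivAt_nonneg {f f' : ℝ → ℝ}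
    (hf : ∀ x, 0 ≤ x → HasDerivAt f (f' x) x) (hf' : ∀ x, 0 ≤ x → 0 ≤ f' x) :
    MonotoneOn f (Set.Ici 0) := by
  refine monotoneOn_of_hasDerivWithinAt_nonneg (f' := f') (convex_Ici 0)
    (fun x hx => (hf x hx).continuousAt.continuousWithinAt) ?_ ?_
  · intro x hx
    rw [interior_Ici] at hx
    exact (hf x (le_of_lt hx)).hasDerivWithinAt
  · intro x hx
    rw [interior_Ici] at hx
    exact hf' x (le_of_lt hx)

theorem isExpanderPair_of_solution {h : ℝ} {u : ℝ → ℝ}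
    (hu : ∀ x : ℝ, 0 ≤ x → DifferentiableAt ℝ u x)
    (hu' : ∀ x : ℝ, 0 ≤ x → DifferentiableAt ℝ (deriv u) x)
    (hode : ∀ x : ℝ, 0 ≤ x →
      u x - x * deriv u x = deriv (deriv u) x / (1 + (deriv u x) ^ 2))
    (h0 : u 0 = h) (h1 : deriv u 0 = 0) :
    IsExpanderPair h (fun x => u x - x * deriv u x) (deriv u) := by
  have key : ∀ x : ℝ, 0 ≤ x →
      deriv (deriv u) x = (u x - x * deriv u x) * (1 + deriv u x ^ 2) := by
    intro x hx
    have : (1 + deriv u x ^ 2) ≠ 0 := by positivity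
    rw [hode x hx, div_mul_cancel₀ _ this]
  refine ⟨by simp [h0], h1, fun x hx => ?_, fun x hx => ?_⟩
  · have := (hu x hx).hasDerivAt.sub ((hasDerivAt_id x).mul (hu' x hx).hasDerivAt)
    rw [key x hx] at this
    refine this.congr_deriv ?_
    simp only [id]
    ring
  · exact key x hx ▸ (hu' x hx).hasDerivAt

namespace IsExpanderPair

variable {h : ℝ} {s p : ℝ → ℝ}

theorem first_integral (H : IsExpanderPair h s p) {x : ℝ} (hx : 0 ≤ x) :
    s x * Real.exp ((x ^ 2 + (s x + x * p x) ^ 2 - Real.log (1 + p x ^ 2)) / 2) =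
      h * Real.exp (h ^ 2 / 2) := by
  have hd : ∀ y, 0 ≤ y → HasDerivAt (fun x => s x *
      Real.exp ((x ^ 2 + (s x + x * p x) ^ 2 - Real.log (1 + p x ^ 2)) / 2)) 0 y := by
    intro y hy
    have hs := H.hasDerivAt_s y hy
    have hp := H.hasDerivAt_p y hy
    have hpos : (1 + p y ^ 2) ≠ 0 := by positivity
    have hlog := ((hp.pow 2).const_add 1).log hpos
    have hu := hs.add ((hasDerivAt_id y).mul hp)
    have := hs.mul (((((hasDerivAt_id y).pow 2).add (hu.pow 2)).sub hlog).div_const 2).exp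
    refine this.congr_deriv ?_
    simp only [id, Pi.add_apply, Pi.mul_apply, Pi.pow_apply, Pi.sub_apply]
    field_simp
    ring
  have := constant_of_has_deriv_right_zero
    (fun y hy => (hd y hy.1).continuousAt.continuousWithinAt)
    (fun y hy => (hd y hy.1).hasDerivWithinAt) x (Set.right_mem_Icc.2 hx)
  simpa [H.s_zero, H.p_zero] using this

theorem s_pos (H : IsExpanderPair h s p) (hh : 0 < h) {x : ℝ} (hx : 0 ≤ x) : 0 < s x := by
  have h1 := H.first_integral hx
  have h2 : 0 < h * Real.exp (h ^ 2 / 2) := by positivity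
  rw [← h1] at h2
  exact pos_of_mul_pos_left h2 (Real.exp_pos _).le

theorem monotoneOn_p (H : IsExpanderPair h s p) (hh : 0 < h) : MonotoneOn p (Set.Ici 0) :=
  monotoneOn_Ici_of_hasDerivAt_nonneg H.hasDerivAt_p fun x hx => by
    have := H.s_pos hh hx
    positivity

theorem p_nonneg (H : IsExpanderPair h s p) (hh : 0 < h) {x : ℝ} (hx : 0 ≤ x) : 0 ≤ p x := by
  simpa [H.p_zero] using H.monotoneOn_p hh Set.self_mem_Ici hx hx

theorem s_le_mul_exp (H : IsExpanderPair h s p) (hh : 0 < h) {x : ℝ} (hx : 0 ≤ x) :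
    s x ≤ h * Real.exp (-(x ^ 2 / 2)) := by
  have hm : MonotoneOn (fun x => -(s x * Real.exp (x ^ 2 / 2))) (Set.Ici 0) := by
    refine monotoneOn_Ici_of_hasDerivAt_nonneg
      (f' := fun x => x * s x * p x ^ 2 * Real.exp (x ^ 2 / 2)) (fun y hy => ?_) (fun y hy => ?_)
    · have := ((H.hasDerivAt_s y hy).mul (((hasDerivAt_id y).pow 2).div_const 2).exp).neg
      refine this.congr_deriv ?_
      simp only [id, Pi.pow_apply]
      ring
    · have := H.s_pos hh hy
      positivity
  have h1 := hm Set.self_mem_Ici hx hx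
  simp only [H.s_zero] at h1
  rw [Real.exp_neg, ← div_eq_mul_inv, le_div_iff₀ (Real.exp_pos _)]
  norm_num at h1
  linarith

theorem s_le (H : IsExpanderPair h s p) (hh : 0 < h) {x : ℝ} (hx : 0 ≤ x) : s x ≤ h :=
  (H.s_le_mul_exp hh hx).trans
    (mul_le_of_le_one_right hh.le (Real.exp_le_one_iff.2 (by nlinarith [sq_nonneg x])))

theorem antitoneOn_chord (H : IsExpanderPair h s p) (hh : 0 < h) :
    AntitoneOn (fun x => p x + s x / x) (Set.Ioi 0) := by
  refine antitoneOn_of_hasDerivWithinAt_nonpos (f' := fun x => -(s x / x ^ 2)) (convex_Ioi 0) ?_ ?_ ?_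
  · intro x hx
    have hx' : (0 : ℝ) < x := hx
    exact ((H.hasDerivAt_p x hx'.le).continuousAt.add
      ((H.hasDerivAt_s x hx'.le).continuousAt.div continuousAt_id hx'.ne')).continuousWithinAt
  · intro x hx
    rw [interior_Ioi] at hx
    have hx' : (0 : ℝ) < x := hx
    have := (H.hasDerivAt_p x hx'.le).add
      ((H.hasDerivAt_s x hx'.le).div (hasDerivAt_id x) hx'.ne')
    refine (this.congr_deriv ?_).hasDerivWithinAt
    simp only [id]
    field_simp
    ring
  · intro x hx
    rw [interior_Ioi] at hx
    have hx' : (0 : ℝ) < x := hx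
    have := H.s_pos hh hx'.le
    simp only [Left.neg_nonpos_iff]
    positivity

theorem p_le_chord (H : IsExpanderPair h s p) (hh : 0 < h) {x y : ℝ} (hx : 0 ≤ x) (hy : 0 < y) :
    p x ≤ p y + s y / y := by
  have hm : 0 < max x y := lt_max_of_lt_right hy
  have h1 := H.monotoneOn_p hh (Set.mem_Ici.2 hx) (Set.mem_Ici.2 hm.le) (le_max_left x y)
  have h2 := H.antitoneOn_chord hh (Set.mem_Ioi.2 hy) (Set.mem_Ioi.2 hm) (le_max_right x y)
  have h3 : 0 ≤ s (max x y) / max x y := div_nonneg (H.s_pos hh hm.le).le hm.le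
  simp only at h2
  linarith

theorem exists_slope (H : IsExpanderPair h s p) (hh : 0 < h) :
    ∃ L, (∀ x, 0 ≤ x → p x ≤ L) ∧ ∀ y, 0 < y → L ≤ p y + s y / y := by
  refine ⟨sSup (p '' Set.Ici 0), fun x hx => le_csSup ?_ ⟨x, hx, rfl⟩, fun y hy => csSup_le ?_ ?_⟩
  · refine ⟨p 1 + s 1 / 1, ?_⟩
    rintro _ ⟨x, hx, rfl⟩
    exact H.p_le_chord hh hx one_pos
  · exact ⟨p 0, 0, Set.self_mem_Ici, rfl⟩
  · rintro _ ⟨x, hx, rfl⟩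
    exact H.p_le_chord hh hx hy

theorem tendsto_sub_slope (H : IsExpanderPair h s p) (hh : 0 < h) {L : ℝ}
    (h1 : ∀ x, 0 ≤ x → p x ≤ L) (h2 : ∀ y, 0 < y → L ≤ p y + s y / y) :
    Tendsto (fun x => s x + x * p x - L * x) atTop (nhds 0) := by
  have ht : Tendsto (fun x : ℝ => h * Real.exp (-(x ^ 2 / 2))) atTop (nhds 0) := by
    have : Tendsto (fun x : ℝ => x ^ 2 / 2) atTop atTop :=
      (tendsto_pow_atTop two_ne_zero).atTop_div_const two_pos
    simpa using (Real.tendsto_exp_neg_atTop_nhds_zero.comp this).const_mul h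
  refine tendsto_of_tendsto_of_tendsto_of_le_of_le' tendsto_const_nhds ht ?_ ?_
  · filter_upwards [eventually_gt_atTop 0] with x hx
    have := mul_le_mul_of_nonneg_right (h2 x hx) hx.le
    rw [add_mul, div_mul_cancel₀ _ hx.ne'] at this
    linarith
  · filter_upwards [eventually_gt_atTop 0] with x hx
    have := mul_le_mul_of_nonneg_right (h1 x hx.le) hx.le
    linarith [H.s_le_mul_exp hh hx.le]

theorem arctan_p_le (H : IsExpanderPair h s p) (hh : 0 < h) {x : ℝ} (hx : 0 ≤ x) :
    Real.arctan (p x) ≤ h * x := by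
  have hm : MonotoneOn (fun x => h * x - Real.arctan (p x)) (Set.Ici 0) := by
    refine monotoneOn_Ici_of_hasDerivAt_nonneg (f' := fun x => h - s x)
      (fun y hy => ?_) (fun y hy => ?_)
    · have := ((hasDerivAt_id y).const_mul h).sub (H.hasDerivAt_p y hy).arctan
      refine this.congr_deriv ?_
      have : (1 + p y ^ 2) ≠ 0 := by positivity
      field_simp
    · linarith [H.s_le hh hy]
  have h1 := hm Set.self_mem_Ici hx hx
  simp [H.p_zero] at h1
  linarith

theorem p_le_tan (H : IsExpanderPair h s p) (hh : 0 < h) {x c : ℝ} (hx : 0 ≤ x)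
    (hc : h * x ≤ c) (hc' : c < Real.pi / 2) : p x ≤ Real.tan c := by
  have h1 := (H.arctan_p_le hh hx).trans hc
  have h0 : 0 ≤ h * x := by positivity
  rw [← Real.tan_arctan (p x)]
  have h2 := Real.neg_pi_div_two_lt_arctan (p x)
  exact Real.strictMonoOn_tan.monotoneOn ⟨h2, by linarith⟩
    ⟨by linarith [Real.pi_pos], hc'⟩ h1

theorem p_le (H : IsExpanderPair h s p) (hh : 0 < h) {x b : ℝ} (hb : h ≤ b) (hx : 0 ≤ x) :
    p x ≤ Real.tan 1 + b * b := by
  have hb0 : 0 < b := hh.trans_le hb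
  have hy : 0 < b⁻¹ := inv_pos.2 hb0
  have h1 := H.p_le_chord hh hx hy
  have h2 : p b⁻¹ ≤ Real.tan 1 := by
    refine H.p_le_tan hh hy.le ?_ (by linarith [Real.pi_gt_three])
    rw [← div_eq_mul_inv, div_le_one hb0]
    exact hb
  have h3 : s b⁻¹ / b⁻¹ ≤ b * b := by
    rw [div_inv_eq_mul]
    exact mul_le_mul_of_nonneg_right ((H.s_le hh hy.le).trans hb) hb0.le
  linarith

theorem lt_slope (H : IsExpanderPair h s p) (hh : 0 < h) {L a : ℝ}
    (h1 : ∀ x, 0 ≤ x → p x ≤ L) (ha : a < h * Real.exp (-((1 + a ^ 2) / 2))) :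
    a < L := by
  by_contra! hL
  have hpa : ∀ x, 0 ≤ x → p x ≤ a := fun x hx => (h1 x hx).trans hL
  have hsq : ∀ x, 0 ≤ x → p x ^ 2 ≤ a ^ 2 := fun x hx =>
    pow_le_pow_left₀ (H.p_nonneg hh hx) (hpa x hx) 2
  have hm : MonotoneOn (fun x => s x * Real.exp ((1 + a ^ 2) * (x ^ 2 / 2))) (Set.Ici 0) := by
    refine monotoneOn_Ici_of_hasDerivAt_nonneg
      (f' := fun x => x * s x * (a ^ 2 - p x ^ 2) * Real.exp ((1 + a ^ 2) * (x ^ 2 / 2)))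
      (fun y hy => ?_) (fun y hy => ?_)
    · have := (H.hasDerivAt_s y hy).mul
        ((((hasDerivAt_id y).pow 2).div_const 2).const_mul (1 + a ^ 2)).exp
      refine this.congr_deriv ?_
      simp only [id, Pi.pow_apply]
      ring
    · have := H.s_pos hh hy
      have := sub_nonneg.2 (hsq y hy)
      positivity
  have hs : ∀ x ∈ Set.Icc (0 : ℝ) 1, h * Real.exp (-((1 + a ^ 2) / 2)) ≤ s x := by
    intro x hx
    have h2 := hm Set.self_mem_Ici hx.1 hx.1
    simp only [H.s_zero] at h2
    norm_num at h2
    rw [Real.exp_neg, ← div_eq_mul_inv, div_le_iff₀ (Real.exp_pos _)]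
    refine h2.trans (mul_le_mul_of_nonneg_left (Real.exp_le_exp.2 ?_) (H.s_pos hh hx.1).le)
    have : x ^ 2 ≤ 1 := pow_le_one₀ hx.1 hx.2
    nlinarith [sq_nonneg a]
  have hp : MonotoneOn (fun x => p x - h * Real.exp (-((1 + a ^ 2) / 2)) * x) (Set.Icc 0 1) := by
    refine monotoneOn_of_hasDerivWithinAt_nonneg
      (f' := fun x => s x * (1 + p x ^ 2) - h * Real.exp (-((1 + a ^ 2) / 2)) * 1)
      (convex_Icc 0 1) (fun x hx => ?_) (fun x hx => ?_) (fun x hx => ?_)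
    · exact ((H.hasDerivAt_p x hx.1).continuousAt.sub
        (continuousAt_const.mul continuousAt_id)).continuousWithinAt
    · have hx := interior_subset hx
      exact ((H.hasDerivAt_p x hx.1).sub ((hasDerivAt_id x).const_mul _)).hasDerivWithinAt
    · have hx := interior_subset hx
      nlinarith [hs x hx, H.s_pos hh hx.1, mul_nonneg (H.s_pos hh hx.1).le (sq_nonneg (p x))]
  have h3 := hp (Set.left_mem_Icc.2 zero_le_one) (Set.right_mem_Icc.2 zero_le_one) zero_le_one
  simp only [H.p_zero] at h3
  linarith [hpa 1 zero_le_one]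

end IsExpanderPair

/-- The vector field of the self-expander system in the variables `(s, p)`. -/
def expanderField (t : ℝ) (z : ℝ × ℝ) : ℝ × ℝ :=
  (-(t * (z.1 * (1 + z.2 ^ 2))), z.1 * (1 + z.2 ^ 2))

theorem lipschitzOnWith_expanderField {b P t T : ℝ} (hb : 0 ≤ b) (hP : 0 ≤ P) (ht : 0 ≤ t)
    (htT : t ≤ T) :
    LipschitzOnWith (Real.toNNReal ((1 + T) * (1 + P ^ 2 + b * (2 * P)))) (expanderField t)
      (Set.Icc 0 b ×ˢ Set.Icc 0 P) := by
  have hT : 0 ≤ T := ht.trans htT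
  refine LipschitzOnWith.of_dist_le_mul ?_
  rintro ⟨s₁, p₁⟩ ⟨⟨hs₁, hs₁'⟩, hp₁, hp₁'⟩ ⟨s₂, p₂⟩ ⟨⟨hs₂, hs₂'⟩, hp₂, hp₂'⟩
  simp only at hs₁ hs₁' hp₁ hp₁' hs₂ hs₂' hp₂ hp₂'
  rw [Real.coe_toNNReal _ (by positivity)]
  set d := dist (s₁, p₁) (s₂, p₂) with hd
  have hd0 : 0 ≤ d := dist_nonneg
  have hds : |s₁ - s₂| ≤ d := by
    rw [hd, Prod.dist_eq, ← Real.dist_eq]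
    exact le_max_left _ _
  have hdp : |p₁ - p₂| ≤ d := by
    rw [hd, Prod.dist_eq, ← Real.dist_eq]
    exact le_max_right _ _
  have hg : |s₁ * (1 + p₁ ^ 2) - s₂ * (1 + p₂ ^ 2)| ≤ (1 + P ^ 2 + b * (2 * P)) * d := by
    have e : s₁ * (1 + p₁ ^ 2) - s₂ * (1 + p₂ ^ 2) =
        (1 + p₁ ^ 2) * (s₁ - s₂) + s₂ * (p₁ + p₂) * (p₁ - p₂) := by ring
    rw [e, add_mul (1 + P ^ 2)]
    refine (abs_add_le _ _).trans (add_le_add ?_ ?_)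
    · rw [abs_mul, abs_of_nonneg (by positivity : 0 ≤ 1 + p₁ ^ 2)]
      gcongr
    · rw [abs_mul, abs_of_nonneg (by positivity : 0 ≤ s₂ * (p₁ + p₂))]
      gcongr
      linarith
  have hc : 0 ≤ (1 + P ^ 2 + b * (2 * P)) * d := by positivity
  simp only [expanderField, Prod.dist_eq, Real.dist_eq]
  refine max_le ?_ ?_
  · have e : -(t * (s₁ * (1 + p₁ ^ 2))) - -(t * (s₂ * (1 + p₂ ^ 2))) =
        -(t * (s₁ * (1 + p₁ ^ 2) - s₂ * (1 + p₂ ^ 2))) := by ring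
    rw [e, abs_neg, abs_mul, abs_of_nonneg ht]
    have := mul_le_mul htT hg (abs_nonneg _) hT
    linarith
  · nlinarith

theorem IsExpanderPair.dist_p_le {b h k T : ℝ} {s p σ π : ℝ → ℝ} (H : IsExpanderPair h s p)
    (K : IsExpanderPair k σ π) (hh : 0 < h) (hk : 0 < k) (hhb : h ≤ b) (hkb : k ≤ b)
    (hT : 0 ≤ T) :
    dist (p T) (π T) ≤ dist h k * Real.exp
      (Real.toNNReal ((1 + T) * (1 + (Real.tan 1 + b * b) ^ 2 + b * (2 * (Real.tan 1 + b * b))))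
        * T) := by
  have hb : 0 ≤ b := hh.le.trans hhb
  have hP : 0 ≤ Real.tan 1 + b * b := (H.p_nonneg hh le_rfl).trans (H.p_le hh hhb le_rfl)
  have hderiv : ∀ {h : ℝ} {s p : ℝ → ℝ}, IsExpanderPair h s p → ∀ t, 0 ≤ t →
      HasDerivAt (fun x => (s x, p x)) (expanderField t (s t, p t)) t :=
    fun H t ht => (H.hasDerivAt_s t ht).prodMk (H.hasDerivAt_p t ht)
  have hmem : ∀ {h : ℝ} {s p : ℝ → ℝ}, IsExpanderPair h s p → 0 < h → h ≤ b → ∀ t, 0 ≤ t →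
      (s t, p t) ∈ Set.Icc 0 b ×ˢ Set.Icc 0 (Real.tan 1 + b * b) :=
    fun H hh hhb t ht => ⟨⟨(H.s_pos hh ht).le, (H.s_le hh ht).trans hhb⟩,
      H.p_nonneg hh ht, H.p_le hh hhb ht⟩
  have key := dist_le_of_trajectories_ODE_of_mem (a := 0) (b := T) (v := expanderField)
    (s := fun _ => Set.Icc 0 b ×ˢ Set.Icc 0 (Real.tan 1 + b * b))
    (f := fun x => (s x, p x)) (g := fun x => (σ x, π x)) (δ := dist h k)
    (fun t ht => lipschitzOnWith_expanderField hb hP ht.1 ht.2.le)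
    (fun t ht => (hderiv H t ht.1).continuousAt.continuousWithinAt)
    (fun t ht => (hderiv H t ht.1).hasDerivWithinAt)
    (fun t ht => hmem H hh hhb t ht.1)
    (fun t ht => (hderiv K t ht.1).continuousAt.continuousWithinAt)
    (fun t ht => (hderiv K t ht.1).hasDerivWithinAt)
    (fun t ht => hmem K hk hkb t ht.1)
    (by simp [H.s_zero, K.s_zero, H.p_zero, K.p_zero, Prod.dist_eq])
    T (Set.right_mem_Icc.2 hT)
  rw [sub_zero] at key
  exact (le_max_right _ _).trans key

theorem continuousOn_slope {s p : ℝ → ℝ → ℝ} {L : ℝ → ℝ}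
    (H : ∀ h, 0 < h → IsExpanderPair h (s h) (p h))
    (h1 : ∀ h, 0 < h → ∀ x, 0 ≤ x → p h x ≤ L h)
    (h2 : ∀ h, 0 < h → ∀ y, 0 < y → L h ≤ p h y + s h y / y) {c b : ℝ} (hc : 0 < c) :
    ContinuousOn L (Set.Icc c b) := by
  refine continuousOn_of_uniform_approx_of_continuousOn fun U hU => ?_
  obtain ⟨ε, hε, hεU⟩ := Metric.mem_uniformity_dist.1 hU
  obtain ⟨T, hT, hTε⟩ : ∃ T : ℝ, 0 < T ∧ b < ε * T :=
    ⟨(|b| + 1) / ε, by positivity, by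
      rw [mul_div_cancel₀ _ hε.ne']
      linarith [le_abs_self b]⟩
  refine ⟨fun h => p h T, ?_, fun h hh => hεU ?_⟩
  · refine (LipschitzOnWith.of_dist_le_mul (K := Real.toNNReal (Real.exp
      (Real.toNNReal ((1 + T) * (1 + (Real.tan 1 + b * b) ^ 2 + b * (2 * (Real.tan 1 + b * b))))
        * T))) fun h hh k hk => ?_).continuousOn
    have hh0 := hc.trans_le hh.1
    have hk0 := hc.trans_le hk.1
    rw [Real.coe_toNNReal _ (Real.exp_pos _).le, mul_comm]
    exact (H h hh0).dist_p_le (H k hk0) hh0 hk0 hh.2 hk.2 hT.le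
  · have hh0 := hc.trans_le hh.1
    have h3 : s h T / T < ε := by
      rw [div_lt_iff₀ hT]
      linarith [(H h hh0).s_le hh0 hT.le, hh.2]
    rw [Real.dist_eq, abs_of_nonneg (sub_nonneg.2 (h1 h hh0 T hT.le))]
    linarith [h2 h hh0 T hT]

/-- For every `a > 0` there exists an initial height `h > 0` such
that the solution of the self-expander ODE with `u(0) = h`, `u'(0) = 0` is
asymptotic at infinity to the half-line `{(x, a·x) : x ≥ 0}`, i.e.
`u(x) - a·x → 0` as `x → ∞`. -/
theorem self_expander_exists_height_for_slope (a : ℝ) (ha : 0 < a) :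
    ∃ h : ℝ, 0 < h ∧
      ∀ u : ℝ → ℝ,
        (∀ x : ℝ, 0 ≤ x → DifferentiableAt ℝ u x) →
        (∀ x : ℝ, 0 ≤ x → DifferentiableAt ℝ (deriv u) x) →
        (∀ x : ℝ, 0 ≤ x →
          u x - x * deriv u x = deriv (deriv u) x / (1 + (deriv u x) ^ 2)) →
        u 0 = h → deriv u 0 = 0 →
        Tendsto (fun x => u x - a * x) atTop (nhds 0) := by
  by_contra! hcon
  have hex : ∀ h : ℝ, ∃ (s p : ℝ → ℝ) (L : ℝ), 0 < h → IsExpanderPair h s p ∧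
      (∀ x, 0 ≤ x → p x ≤ L) ∧ (∀ y, 0 < y → L ≤ p y + s y / y) ∧ L ≠ a := by
    intro h
    by_cases hh : 0 < h
    · obtain ⟨u, hu, hu', hode, h0, h1, hnot⟩ := hcon h hh
      have H := isExpanderPair_of_solution hu hu' hode h0 h1
      obtain ⟨L, hL1, hL2⟩ := H.exists_slope hh
      refine ⟨_, _, L, fun _ => ⟨H, hL1, hL2, ?_⟩⟩
      rintro rfl
      refine hnot ?_
      simpa using H.tendsto_sub_slope hh hL1 hL2
    · exact ⟨0, 0, 0, fun h => absurd h hh⟩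
  choose s p L hL using hex
  obtain ⟨c, hc0, hc1, hca⟩ : ∃ c : ℝ, 0 < c ∧ c < 1 ∧ Real.tan c + c < a := by
    have hcont : ContinuousAt (fun c : ℝ => Real.tan c + c) 0 :=
      (Real.continuousAt_tan.2 (by simp)).add continuousAt_id
    have hlt : ∀ᶠ c in nhds (0 : ℝ), Real.tan c + c < a :=
      hcont.eventually_lt continuousAt_const (by simpa using ha)
    obtain ⟨δ, hδ, hball⟩ := Metric.eventually_nhds_iff.1 hlt
    refine ⟨min δ 1 / 2, by positivity, by linarith [min_le_right δ 1], hball ?_⟩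
    rw [Real.dist_eq, sub_zero, abs_of_pos (by positivity)]
    linarith [min_le_left δ 1, lt_min hδ one_pos]
  set b := (a + 1) * Real.exp ((1 + a ^ 2) / 2) with hb
  have hb1 : 1 < b := one_lt_mul_of_lt_of_le (by linarith) (Real.one_le_exp (by positivity))
  have hb0 : 0 < b := one_pos.trans hb1
  have hLc : L c ≤ a := by
    obtain ⟨H, -, h2, -⟩ := hL c hc0
    have h3 := h2 1 one_pos
    have h4 := H.p_le_tan hc0 zero_le_one (mul_one c).le (by linarith [Real.pi_gt_three])
    have h5 := H.s_le hc0 zero_le_one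
    rw [div_one] at h3
    linarith
  have hLb : a ≤ L b := by
    obtain ⟨H, h1, -, -⟩ := hL b hb0
    refine (H.lt_slope hb0 h1 ?_).le
    rw [hb, mul_assoc, ← Real.exp_add, add_neg_cancel, Real.exp_zero]
    linarith
  obtain ⟨h, hh, hha⟩ := intermediate_value_Icc (hc1.trans hb1).le
    (continuousOn_slope (fun h hh => (hL h hh).1) (fun h hh => (hL h hh).2.1)
      (fun h hh => (hL h hh).2.2.1) hc0) ⟨hLc, hLb⟩
  exact (hL h (hc0.trans_le hh.1)).2.2.2 hha
end

section
/- There exists a function A : (0, ∞) → (0, ∞) such that for every h > 0 and every twice differentiable solution u : [0, ∞) → ℝ of u(x) − x·u′(x) = u″(x)/(1 + u′(x)²) with u(0) = h and u′(0) = 0, the asymptotic slope satisfies lim_{x→∞} u(x)/x = A(h); moreover A is continuous, strictly increasing, and a bijection from (0, ∞) onto (0, ∞), with A(h) → ∞ as h → ∞ and A(h) → 0 as h → 0. In other words, the correspondence between initial height h and asymptotic slope a is a homeomorphism. -/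
open Filter
open Real Set Topology MeasureTheory intervalIntegral

/-- The integrand of the total turning angle of the expander of initial height `h`, as a function
of the support function normalised by `h`. -/
noncomputable def turningDensity (h t : ℝ) : ℝ := (√(1 - t ^ 2 - 2 * log t / h ^ 2))⁻¹

/-- The total turning angle of the expander of initial height `h` over `[0, ∞)`. -/
noncomputable def turningAngle (h : ℝ) : ℝ := ∫ t in (0 : ℝ)..1, turningDensity h t

/-- The pointwise limit of `turningDensity h` as `h → ∞`. -/
noncomputable def limitDensity (t : ℝ) : ℝ := (√(1 - t ^ 2))⁻¹

lemma one_sub_sq_pos {t : ℝ} (ht : t ∈ Ioo (0 : ℝ) 1) : 0 < 1 - t ^ 2 := by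
  nlinarith [ht.1, ht.2]

lemma one_sub_sq_lt_radicand {h t : ℝ} (hh : 0 < h) (ht : t ∈ Ioo (0 : ℝ) 1) :
    1 - t ^ 2 < 1 - t ^ 2 - 2 * log t / h ^ 2 := by
  have : 2 * log t / h ^ 2 < 0 :=
    div_neg_of_neg_of_pos (by linarith [log_neg ht.1 ht.2]) (by positivity)
  linarith

lemma turningDensity_pos {h t : ℝ} (hh : 0 < h) (ht : t ∈ Ioo (0 : ℝ) 1) :
    0 < turningDensity h t :=
  inv_pos.2 (sqrt_pos.2 ((one_sub_sq_pos ht).trans (one_sub_sq_lt_radicand hh ht)))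

lemma turningDensity_lt_limitDensity {h t : ℝ} (hh : 0 < h) (ht : t ∈ Ioo (0 : ℝ) 1) :
    turningDensity h t < limitDensity t :=
  inv_strictAnti₀ (sqrt_pos.2 (one_sub_sq_pos ht))
    (sqrt_lt_sqrt (one_sub_sq_pos ht).le (one_sub_sq_lt_radicand hh ht))

lemma turningDensity_strictMonoOn {t : ℝ} (ht : t ∈ Ioo (0 : ℝ) 1) :
    StrictMonoOn (fun h => turningDensity h t) (Ioi 0) := by
  intro h hh k hk hhk
  have hh : 0 < h := hh
  have hk : 0 < k := hk
  have hpos := (one_sub_sq_pos ht).trans (one_sub_sq_lt_radicand hk ht)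
  refine inv_strictAnti₀ (sqrt_pos.2 hpos) (sqrt_lt_sqrt hpos.le ?_)
  have : -(2 * log t) / k ^ 2 < -(2 * log t) / h ^ 2 :=
    div_lt_div_of_pos_left (by linarith [log_neg ht.1 ht.2]) (by positivity) (by gcongr)
  rw [neg_div, neg_div] at this
  linarith

lemma measurable_turningDensity (h : ℝ) : Measurable (turningDensity h) := by
  unfold turningDensity
  fun_prop

lemma hasDerivAt_arcsin_limitDensity {t : ℝ} (ht : t ∈ Ioo (0 : ℝ) 1) :
    HasDerivAt arcsin (limitDensity t) t := by
  simpa [limitDensity] using hasDerivAt_arcsin (x := t) (by linarith [ht.1]) ht.2.ne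

lemma limitDensity_intervalIntegrable : IntervalIntegrable limitDensity volume 0 1 := by
  refine intervalIntegrable_deriv_of_nonneg (g := arcsin) continuous_arcsin.continuousOn ?_ ?_
  · intro x hx
    exact hasDerivAt_arcsin_limitDensity (by simpa using hx)
  · intro x _
    exact inv_nonneg.2 (sqrt_nonneg _)

lemma integral_limitDensity : ∫ t in (0 : ℝ)..1, limitDensity t = π / 2 := by
  rw [integral_eq_sub_of_hasDerivAt_of_le zero_le_one continuous_arcsin.continuousOn
    (fun _ => hasDerivAt_arcsin_limitDensity) limitDensity_intervalIntegrable]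
  simp

lemma ae_mem_Ioo_of_mem_uIoc : ∀ᵐ t : ℝ, t ∈ uIoc (0 : ℝ) 1 → t ∈ Ioo (0 : ℝ) 1 := by
  filter_upwards [Measure.ae_ne volume (1 : ℝ)] with t ht hmem
  rw [uIoc_of_le zero_le_one] at hmem
  exact ⟨hmem.1, lt_of_le_of_ne hmem.2 ht⟩

lemma ae_norm_turningDensity_le {h : ℝ} (hh : 0 < h) :
    ∀ᵐ t : ℝ, t ∈ uIoc (0 : ℝ) 1 → ‖turningDensity h t‖ ≤ limitDensity t := by
  filter_upwards [ae_mem_Ioo_of_mem_uIoc] with t ht hmem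
  rw [norm_of_nonneg (turningDensity_pos hh (ht hmem)).le]
  exact (turningDensity_lt_limitDensity hh (ht hmem)).le

lemma turningDensity_intervalIntegrable {h : ℝ} (hh : 0 < h) :
    IntervalIntegrable (turningDensity h) volume 0 1 :=
  limitDensity_intervalIntegrable.mono_fun' (measurable_turningDensity h).aestronglyMeasurable
    ((ae_restrict_iff' measurableSet_uIoc).2 (ae_norm_turningDensity_le hh))

lemma tendsto_turningAngle {l : Filter ℝ} [l.IsCountablyGenerated] {g : ℝ → ℝ}
    (hl : ∀ᶠ h in l, 0 < h)
    (hg : ∀ t ∈ Ioo (0 : ℝ) 1, Tendsto (fun h => turningDensity h t) l (𝓝 (g t))) :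
    Tendsto turningAngle l (𝓝 (∫ t in (0 : ℝ)..1, g t)) := by
  refine tendsto_integral_filter_of_dominated_convergence limitDensity ?_ ?_
    limitDensity_intervalIntegrable ?_
  · exact .of_forall fun h => (measurable_turningDensity h).aestronglyMeasurable
  · exact hl.mono fun h hh => ae_norm_turningDensity_le hh
  · filter_upwards [ae_mem_Ioo_of_mem_uIoc] with t ht hmem using hg t (ht hmem)

lemma continuousOn_turningAngle : ContinuousOn turningAngle (Ioi 0) := by
  intro h hh
  have hh : 0 < h := hh
  refine ContinuousAt.continuousWithinAt
    (tendsto_turningAngle (eventually_gt_nhds hh) fun t ht => ?_)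
  have hne : √(1 - t ^ 2 - 2 * log t / h ^ 2) ≠ 0 :=
    (sqrt_pos.2 ((one_sub_sq_pos ht).trans (one_sub_sq_lt_radicand hh ht))).ne'
  have hcont : ContinuousAt (fun k : ℝ => 1 - t ^ 2 - 2 * log t / k ^ 2) h := by
    fun_prop (disch := positivity)
  exact hcont.sqrt.inv₀ hne

lemma tendsto_turningAngle_atTop : Tendsto turningAngle atTop (𝓝 (π / 2)) := by
  rw [← integral_limitDensity]
  refine tendsto_turningAngle (eventually_gt_atTop 0) fun t ht => ?_
  have hlim : Tendsto (fun h : ℝ => 1 - t ^ 2 - 2 * log t / h ^ 2) atTop (𝓝 (1 - t ^ 2)) := by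
    simpa using (tendsto_const_nhds (x := 1 - t ^ 2)).sub
      ((tendsto_const_nhds (x := 2 * log t)).div_atTop
        (tendsto_pow_atTop (α := ℝ) two_ne_zero))
  exact hlim.sqrt.inv₀ (sqrt_pos.2 (one_sub_sq_pos ht)).ne'

lemma tendsto_turningAngle_zero : Tendsto turningAngle (𝓝[>] 0) (𝓝 0) := by
  have key := tendsto_turningAngle (l := 𝓝[>] (0 : ℝ)) (g := fun _ => 0) self_mem_nhdsWithin ?_
  · simpa using key
  intro t ht
  have hsq : Tendsto (fun h : ℝ => (h ^ 2)⁻¹) (𝓝[>] 0) atTop := by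
    simpa only [inv_pow, Function.comp_def] using
      (tendsto_pow_atTop (two_ne_zero)).comp (tendsto_inv_nhdsGT_zero (𝕜 := ℝ))
  have hlim : Tendsto (fun h : ℝ => 1 - t ^ 2 - 2 * log t / h ^ 2) (𝓝[>] 0) atTop := by
    have h2 := tendsto_atTop_add_const_left _ (1 - t ^ 2)
      (hsq.const_mul_atTop (show 0 < -(2 * log t) by linarith [log_neg ht.1 ht.2]))
    refine h2.congr fun h => ?_
    ring
  exact (tendsto_sqrt_atTop.comp hlim).inv_tendsto_atTop

lemma turningAngle_pos {h : ℝ} (hh : 0 < h) : 0 < turningAngle h :=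
  intervalIntegral_pos_of_pos_on (turningDensity_intervalIntegrable hh)
    (fun _ => turningDensity_pos hh) zero_lt_one

lemma turningAngle_lt_pi_div_two {h : ℝ} (hh : 0 < h) : turningAngle h < π / 2 := by
  rw [← integral_limitDensity, turningAngle, ← sub_pos,
    ← integral_sub limitDensity_intervalIntegrable (turningDensity_intervalIntegrable hh)]
  exact intervalIntegral_pos_of_pos_on
    (limitDensity_intervalIntegrable.sub (turningDensity_intervalIntegrable hh))
    (fun _ ht => sub_pos.2 (turningDensity_lt_limitDensity hh ht)) zero_lt_one

lemma turningAngle_strictMonoOn : StrictMonoOn turningAngle (Ioi 0) := by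
  intro h hh k hk hhk
  rw [turningAngle, turningAngle, ← sub_pos,
    ← integral_sub (turningDensity_intervalIntegrable hk) (turningDensity_intervalIntegrable hh)]
  exact intervalIntegral_pos_of_pos_on
    ((turningDensity_intervalIntegrable hk).sub (turningDensity_intervalIntegrable hh))
    (fun _ ht => sub_pos.2 (turningDensity_strictMonoOn ht hh hk hhk)) zero_lt_one

lemma turningAngle_mem_Ioo {h : ℝ} (hh : 0 < h) : turningAngle h ∈ Ioo (-(π / 2)) (π / 2) :=
  ⟨by linarith [turningAngle_pos hh, pi_pos], turningAngle_lt_pi_div_two hh⟩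

lemma hasDerivAt_integral_turningDensity {h s : ℝ} (hh : 0 < h) (hs : s ∈ Ioo (0 : ℝ) 1) :
    HasDerivAt (fun y => ∫ t in (0 : ℝ)..y, turningDensity h t) (turningDensity h s) s := by
  refine integral_hasDerivAt_right ?_
    (measurable_turningDensity h).stronglyMeasurable.stronglyMeasurableAtFilter ?_
  · refine (turningDensity_intervalIntegrable hh).mono_set ?_
    rw [uIcc_of_le hs.1.le, uIcc_of_le zero_le_one]
    exact Icc_subset_Icc_right hs.2.le
  · have hne : √(1 - s ^ 2 - 2 * log s / h ^ 2) ≠ 0 :=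
      (sqrt_pos.2 ((one_sub_sq_pos hs).trans (one_sub_sq_lt_radicand hh hs))).ne'
    have hs0 : s ≠ 0 := hs.1.ne'
    have hcont : ContinuousAt (fun t : ℝ => 1 - t ^ 2 - 2 * log t / h ^ 2) s := by
      fun_prop (disch := assumption)
    exact hcont.sqrt.inv₀ hne

lemma continuousOn_integral_turningDensity {h : ℝ} (hh : 0 < h) :
    ContinuousOn (fun y => ∫ t in (0 : ℝ)..y, turningDensity h t) (Icc 0 1) := by
  simpa [uIcc_of_le] using
    continuousOn_primitive_interval' (turningDensity_intervalIntegrable hh) left_mem_uIcc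

lemma eq_zero_value_of_hasDerivAt_zero {g : ℝ → ℝ} (hcont : ContinuousOn g (Ici 0))
    (hderiv : ∀ x, 0 < x → HasDerivAt g 0 x) {x : ℝ} (hx : 0 ≤ x) : g x = g 0 := by
  have key := integral_eq_sub_of_hasDerivAt_of_le hx (hcont.mono Icc_subset_Ici_self)
    (fun y hy => hderiv y hy.1) (by simp)
  rw [intervalIntegral.integral_zero] at key
  linarith

/-- A solution on `[0, ∞)` of the self-expander equation with horizontal tangent at height `h`. -/
structure IsExpander (h : ℝ) (u p : ℝ → ℝ) : Prop where
  hasDerivAt_height : ∀ x, 0 ≤ x → HasDerivAt u (p x) x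
  hasDerivAt_slope : ∀ x, 0 ≤ x → HasDerivAt p ((1 + p x ^ 2) * (u x - x * p x)) x
  height_zero : u 0 = h
  slope_zero : p 0 = 0

/-- The support function of the expander divided by its initial value, in terms of the height. -/
noncomputable def normalizedSupport (h : ℝ) (u : ℝ → ℝ) (x : ℝ) : ℝ :=
  exp ((h ^ 2 - x ^ 2 - u x ^ 2) / 2)

namespace IsExpander

variable {h : ℝ} {u p : ℝ → ℝ}

lemma hasDerivAt_intercept (hu : IsExpander h u p) {x : ℝ} (hx : 0 ≤ x) :
    HasDerivAt (fun x => u x - x * p x) (-x * ((1 + p x ^ 2) * (u x - x * p x))) x := by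
  refine ((hu.hasDerivAt_height x hx).sub
    ((hasDerivAt_id x).mul (hu.hasDerivAt_slope x hx))).congr_deriv ?_
  simp only [id]
  ring

lemma sq_intercept (hu : IsExpander h u p) {x : ℝ} (hx : 0 ≤ x) :
    (u x - x * p x) ^ 2 = h ^ 2 * normalizedSupport h u x ^ 2 * (1 + p x ^ 2) := by
  have hderiv : ∀ y, 0 ≤ y → HasDerivAt
      (fun y => (u y - y * p y) ^ 2 * exp (y ^ 2 + u y ^ 2) / (1 + p y ^ 2)) 0 y := by
    intro y hy
    have hw := hu.hasDerivAt_intercept hy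
    have hp := hu.hasDerivAt_slope y hy
    have hv := hu.hasDerivAt_height y hy
    have hden : 1 + p y ^ 2 ≠ 0 := by positivity
    refine (((hw.pow 2).mul (((hasDerivAt_id y).pow 2).add (hv.pow 2)).exp).div
      ((hp.pow 2).const_add 1) hden).congr_deriv ?_
    simp only [id, Pi.pow_apply, Pi.add_apply, Pi.mul_apply]
    field_simp
    ring
  have hconst := eq_zero_value_of_hasDerivAt_zero
    (fun y hy => (hderiv y hy).continuousAt.continuousWithinAt) (fun y hy => hderiv y hy.le) hx
  have hden : 1 + p x ^ 2 ≠ 0 := by positivity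
  rw [div_eq_iff hden] at hconst
  simp only [hu.height_zero, hu.slope_zero] at hconst
  have hexp : normalizedSupport h u x ^ 2 * exp (x ^ 2 + u x ^ 2) = exp (0 ^ 2 + h ^ 2) := by
    rw [normalizedSupport, ← exp_nat_mul, ← exp_add]
    congr 1
    push_cast
    ring
  refine mul_right_cancel₀ (exp_pos (x ^ 2 + u x ^ 2)).ne' ?_
  rw [hconst, ← hexp]
  ring

lemma intercept_pos (hu : IsExpander h u p) (hh : 0 < h) {x : ℝ} (hx : 0 ≤ x) :
    0 < u x - x * p x := by
  have hne : ∀ y, 0 ≤ y → u y - y * p y ≠ 0 := fun y hy h0 => by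
    have hsq := hu.sq_intercept hy
    rw [h0] at hsq
    have : 0 < normalizedSupport h u y := exp_pos _
    have : 0 < h ^ 2 * normalizedSupport h u y ^ 2 * (1 + p y ^ 2) := by positivity
    linarith
  by_contra! hneg
  have hcont : ContinuousOn (fun y => u y - y * p y) (Icc 0 x) := fun y hy =>
    (hu.hasDerivAt_intercept hy.1).continuousAt.continuousWithinAt
  obtain ⟨y, hy, hy0⟩ := intermediate_value_Icc' hx hcont
    (show (0 : ℝ) ∈ Icc (u x - x * p x) (u 0 - 0 * p 0) from
      ⟨hneg, by simp [hu.height_zero, hh.le]⟩)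
  exact hne y hy.1 hy0

lemma intercept_eq (hu : IsExpander h u p) (hh : 0 < h) {x : ℝ} (hx : 0 ≤ x) :
    u x - x * p x = h * normalizedSupport h u x * √(1 + p x ^ 2) := by
  have hs : 0 < normalizedSupport h u x := exp_pos _
  rw [← pow_left_inj₀ (hu.intercept_pos hh hx).le (by positivity) two_ne_zero,
    hu.sq_intercept hx, mul_pow, mul_pow, sq_sqrt (by positivity)]

lemma slope_nonneg (hu : IsExpander h u p) (hh : 0 < h) {x : ℝ} (hx : 0 ≤ x) : 0 ≤ p x := by
  have hmono : MonotoneOn p (Ici 0) := by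
    refine monotoneOn_of_hasDerivWithinAt_nonneg (convex_Ici 0)
      (f' := fun x => (1 + p x ^ 2) * (u x - x * p x))
      (fun y hy => (hu.hasDerivAt_slope y hy).continuousAt.continuousWithinAt) ?_ ?_
    · intro y hy
      rw [interior_Ici] at hy
      exact (hu.hasDerivAt_slope y hy.le).hasDerivWithinAt
    · intro y hy
      rw [interior_Ici] at hy
      have := hu.intercept_pos hh hy.le
      positivity
  simpa [hu.slope_zero] using hmono self_mem_Ici (mem_Ici.2 hx) hx

lemma height_le (hu : IsExpander h u p) (hh : 0 < h) {x : ℝ} (hx : 0 ≤ x) : h ≤ u x := by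
  have hmono : MonotoneOn u (Ici 0) := by
    refine monotoneOn_of_hasDerivWithinAt_nonneg (convex_Ici 0) (f' := p)
      (fun y hy => (hu.hasDerivAt_height y hy).continuousAt.continuousWithinAt) ?_ ?_
    · intro y hy
      rw [interior_Ici] at hy
      exact (hu.hasDerivAt_height y hy.le).hasDerivWithinAt
    · intro y hy
      rw [interior_Ici] at hy
      exact hu.slope_nonneg hh hy.le
  simpa [hu.height_zero] using hmono self_mem_Ici (mem_Ici.2 hx) hx

lemma normalizedSupport_le (hu : IsExpander h u p) (hh : 0 < h) {x : ℝ} (hx : 0 ≤ x) :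
    normalizedSupport h u x ≤ exp (-x ^ 2 / 2) := by
  have := hu.height_le hh hx
  refine exp_le_exp.2 ?_
  nlinarith

lemma normalizedSupport_mem_Ioo (hu : IsExpander h u p) (hh : 0 < h) {x : ℝ} (hx : 0 < x) :
    normalizedSupport h u x ∈ Ioo (0 : ℝ) 1 := by
  refine ⟨exp_pos _, (hu.normalizedSupport_le hh hx.le).trans_lt (exp_lt_one_iff.2 ?_)⟩
  nlinarith

lemma normalizedSupport_mem_Icc (hu : IsExpander h u p) (hh : 0 < h) {x : ℝ} (hx : 0 ≤ x) :
    normalizedSupport h u x ∈ Icc (0 : ℝ) 1 := by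
  refine ⟨(exp_pos _).le, (hu.normalizedSupport_le hh hx).trans (exp_le_one_iff.2 ?_)⟩
  nlinarith

lemma hasDerivAt_normalizedSupport (hu : IsExpander h u p) {x : ℝ} (hx : 0 ≤ x) :
    HasDerivAt (normalizedSupport h u) (-(x + p x * u x) * normalizedSupport h u x) x := by
  refine (((((hasDerivAt_id x).pow 2).const_sub (h ^ 2)).sub
    ((hu.hasDerivAt_height x hx).pow 2)).div_const 2).exp.congr_deriv ?_
  simp only [normalizedSupport, id, Pi.pow_apply, Pi.sub_apply]
  ring

lemma turningDensity_normalizedSupport (hu : IsExpander h u p) (hh : 0 < h) {x : ℝ} (hx : 0 < x) :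
    turningDensity h (normalizedSupport h u x) = h * √(1 + p x ^ 2) / (x + p x * u x) := by
  have hpos : 0 < x + p x * u x :=
    add_pos_of_pos_of_nonneg hx
      (mul_nonneg (hu.slope_nonneg hh hx.le) (hh.le.trans (hu.height_le hh hx.le)))
  have hD : 0 < 1 + p x ^ 2 := by positivity
  have hrad : 1 - normalizedSupport h u x ^ 2 - 2 * log (normalizedSupport h u x) / h ^ 2 =
      ((x + p x * u x) / (h * √(1 + p x ^ 2))) ^ 2 := by
    have hlog : log (normalizedSupport h u x) = (h ^ 2 - x ^ 2 - u x ^ 2) / 2 := log_exp _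
    have hsq : normalizedSupport h u x ^ 2 = (u x - x * p x) ^ 2 / (h ^ 2 * (1 + p x ^ 2)) := by
      rw [hu.sq_intercept hx.le]
      field_simp
    rw [hlog, hsq, div_pow, mul_pow, sq_sqrt hD.le]
    field_simp
    ring
  rw [turningDensity, hrad, sqrt_sq (by positivity), inv_div]

lemma arctan_add_integral_eq (hu : IsExpander h u p) (hh : 0 < h) {x : ℝ} (hx : 0 ≤ x) :
    arctan (p x) + ∫ t in (0 : ℝ)..normalizedSupport h u x, turningDensity h t =
      turningAngle h := by
  have hcont : ContinuousOn (fun x => arctan (p x) +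
      ∫ t in (0 : ℝ)..normalizedSupport h u x, turningDensity h t) (Ici 0) := by
    refine ContinuousOn.add (fun y hy =>
      (hu.hasDerivAt_slope y hy).arctan.continuousAt.continuousWithinAt) ?_
    exact (continuousOn_integral_turningDensity hh).comp
      (fun y hy => (hu.hasDerivAt_normalizedSupport hy).continuousAt.continuousWithinAt)
      (fun y hy => hu.normalizedSupport_mem_Icc hh hy)
  rw [eq_zero_value_of_hasDerivAt_zero hcont _ hx]
  · simp [normalizedSupport, hu.height_zero, hu.slope_zero, turningAngle]
  intro y hy
  have hpos : 0 < y + p y * u y :=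
    add_pos_of_pos_of_nonneg hy
      (mul_nonneg (hu.slope_nonneg hh hy.le) (hh.le.trans (hu.height_le hh hy.le)))
  refine ((hu.hasDerivAt_slope y hy.le).arctan.add
    ((hasDerivAt_integral_turningDensity hh (hu.normalizedSupport_mem_Ioo hh hy)).comp y
      (hu.hasDerivAt_normalizedSupport hy.le))).congr_deriv ?_
  rw [hu.turningDensity_normalizedSupport hh hy, hu.intercept_eq hh hy.le]
  field_simp
  ring

lemma tendsto_normalizedSupport (hu : IsExpander h u p) (hh : 0 < h) :
    Tendsto (normalizedSupport h u) atTop (𝓝 0) := by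
  refine squeeze_zero' (.of_forall fun x => (exp_pos _).le)
    ((eventually_ge_atTop 0).mono fun x hx => hu.normalizedSupport_le hh hx) ?_
  refine tendsto_exp_atBot.comp (Tendsto.atBot_div_const two_pos ?_)
  exact tendsto_neg_atTop_atBot.comp (tendsto_pow_atTop two_ne_zero)

lemma tendsto_slope (hu : IsExpander h u p) (hh : 0 < h) :
    Tendsto p atTop (𝓝 (tan (turningAngle h))) := by
  have hint : Tendsto (fun x => ∫ t in (0 : ℝ)..normalizedSupport h u x, turningDensity h t)
      atTop (𝓝 0) := by
    have h0 := (continuousOn_integral_turningDensity hh) 0 (by simp)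
    rw [ContinuousWithinAt, integral_same] at h0
    exact h0.comp (tendsto_nhdsWithin_iff.2 ⟨hu.tendsto_normalizedSupport hh,
      (eventually_ge_atTop 0).mono fun x hx => hu.normalizedSupport_mem_Icc hh hx⟩)
  have harctan : Tendsto (fun x => arctan (p x)) atTop (𝓝 (turningAngle h)) := by
    refine Tendsto.congr' ?_ (by simpa using hint.const_sub (turningAngle h))
    filter_upwards [eventually_ge_atTop 0] with x hx
    linarith [hu.arctan_add_integral_eq hh hx]
  have hcos := (cos_pos_of_mem_Ioo (turningAngle_mem_Ioo hh)).ne'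
  simpa [Function.comp_def] using (continuousAt_tan.2 hcos).tendsto.comp harctan

theorem tendsto_height_div (hu : IsExpander h u p) (hh : 0 < h) :
    Tendsto (fun x => u x / x) atTop (𝓝 (tan (turningAngle h))) := by
  have hp := hu.tendsto_slope hh
  have hw : Tendsto (fun x => h * normalizedSupport h u x * √(1 + p x ^ 2) / x) atTop (𝓝 0) :=
    Tendsto.div_atTop (((hu.tendsto_normalizedSupport hh).const_mul h).mul
      ((hp.pow 2).const_add 1).sqrt) tendsto_id
  refine Tendsto.congr' ?_ (by simpa using hp.add hw)
  filter_upwards [eventually_gt_atTop 0] with x hx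
  rw [← hu.intercept_eq hh hx.le]
  field_simp
  ring

end IsExpander

/-- The map from the initial height `h > 0` to the asymptotic
slope `a = lim_{x→∞} u(x)/x` of the solution of the self-expander ODE with
`u(0) = h`, `u'(0) = 0` is well defined and is a homeomorphism of `(0, ∞)` onto
`(0, ∞)`: it is continuous, strictly increasing, bijective onto `(0, ∞)`, and
`A(h) → ∞` as `h → ∞`, `A(h) → 0` as `h → 0⁺`. -/
theorem self_expander_height_slope_homeomorphism :
    ∃ A : ℝ → ℝ,
      (∀ h : ℝ, 0 < h → 0 < A h) ∧
      (∀ h : ℝ, 0 < h →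
        ∀ u : ℝ → ℝ,
          (∀ x : ℝ, 0 ≤ x → DifferentiableAt ℝ u x) →
          (∀ x : ℝ, 0 ≤ x → DifferentiableAt ℝ (deriv u) x) →
          (∀ x : ℝ, 0 ≤ x →
            u x - x * deriv u x = deriv (deriv u) x / (1 + (deriv u x) ^ 2)) →
          u 0 = h → deriv u 0 = 0 →
          Tendsto (fun x => u x / x) atTop (nhds (A h))) ∧
      ContinuousOn A (Set.Ioi 0) ∧
      StrictMonoOn A (Set.Ioi 0) ∧
      (∀ a : ℝ, 0 < a → ∃ h : ℝ, 0 < h ∧ A h = a) ∧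
      Tendsto A atTop atTop ∧
      Tendsto A (nhdsWithin 0 (Set.Ioi 0)) (nhds 0) := by
  have hcontA : ContinuousOn (fun h => tan (turningAngle h)) (Ioi 0) :=
    continuousOn_tan_Ioo.comp continuousOn_turningAngle fun h hh => turningAngle_mem_Ioo hh
  have htop : Tendsto (fun h => tan (turningAngle h)) atTop atTop :=
    tendsto_tan_pi_div_two.comp (tendsto_nhdsWithin_iff.2 ⟨tendsto_turningAngle_atTop,
      (eventually_gt_atTop 0).mono fun h hh => turningAngle_lt_pi_div_two hh⟩)
  have hzero : Tendsto (fun h => tan (turningAngle h)) (𝓝[>] 0) (𝓝 0) := by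
    have htan := (continuousAt_tan (x := 0)).2 (by simp)
    rw [ContinuousAt, tan_zero] at htan
    exact htan.comp tendsto_turningAngle_zero
  refine ⟨fun h => tan (turningAngle h), ?_, ?_, hcontA, ?_, ?_, htop, hzero⟩
  · exact fun h hh => tan_pos_of_pos_of_lt_pi_div_two (turningAngle_pos hh)
      (turningAngle_lt_pi_div_two hh)
  · intro h hh u hu hu' hode h0 h0'
    refine IsExpander.tendsto_height_div (p := deriv u)
      ⟨fun x hx => (hu x hx).hasDerivAt, fun x hx => ?_, h0, h0'⟩ hh
    refine (hu' x hx).hasDerivAt.congr_deriv ?_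
    rw [hode x hx, mul_div_cancel₀ _ (by positivity)]
  · exact strictMonoOn_tan.comp turningAngle_strictMonoOn fun h hh => turningAngle_mem_Ioo hh
  · intro a ha
    exact isPreconnected_Ioi.intermediate_value_Ioi (l₁ := 𝓝[>] (0 : ℝ)) (l₂ := atTop)
      (le_principal_iff.2 self_mem_nhdsWithin) (le_principal_iff.2 (Ioi_mem_atTop 0))
      hcontA hzero htop ha
end
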